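/- arXiv:1906.02320 — 2 statements merged into one kernel-verified Lean document; each statement's English description precedes it below -/
import Mathlib

section
/- Let Ω ⊂ ℝ² be a planar convex body, M > 0, and let u_* minimize Newton's functional F(u) = ∫∫_Ω (1 + |∇u(x,y)|²)^{-1} dx dy in the class of concave functions u : Ω → [0, M]. If the upper level set L_M = {(x,y) ∈ Ω : u_*(x,y) = M} has nonempty interior, then for almost all points (x̄, ȳ) ∈ ∂L_M one has lim |∇u_*(x,y)| = 1 as (x,y) → (x̄, ȳ) with (x,y) ∈ Ω \ L_M. -/
open MeasureTheory Set Filter Topology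
open scoped RealInnerProductSpace ENNReal

noncomputable section

attribute [local instance] Classical.propDecidable

abbrev E2 := EuclideanSpace ℝ (Fin 2)

/-- A planar convex body: a compact convex set in `ℝ²` with nonempty interior. -/
def IsConvexBody2 (C : Set E2) : Prop :=
  IsCompact C ∧ Convex ℝ C ∧ (interior C).Nonempty

/-- Newton's resistance functional `F(u) = ∫∫_Ω (1 + |∇u(x,y)|²)⁻¹ dx dy`. -/
def NewtonF (Ω : Set E2) (u : E2 → ℝ) : ℝ :=
  ∫ p in Ω, (1 + ‖gradient u p‖ ^ 2)⁻¹

/-- The admissible class of Newton's problem: concave functions `u : Ω → [0, M]`. -/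
def NewtonAdmissible (Ω : Set E2) (M : ℝ) (u : E2 → ℝ) : Prop :=
  ConcaveOn ℝ Ω u ∧ ∀ p ∈ Ω, u p ∈ Icc 0 M

lemma inner_gradient_eq {u : E2 → ℝ} {x : E2} (w : E2) :
    ⟪gradient u x, w⟫ = fderiv ℝ u x w := by
  simp [gradient]

lemma support_of_diff {Ω : Set E2} {u : E2 → ℝ} (hu : ConcaveOn ℝ Ω u) {x y : E2}
    (hx : x ∈ Ω) (hy : y ∈ Ω) (hd : DifferentiableAt ℝ u x) :
    u y ≤ u x + ⟪gradient u x, y - x⟫ := by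
  rw [inner_gradient_eq]
  have h1 : HasDerivAt (fun t : ℝ => u (x + t • (y - x))) (fderiv ℝ u x (y - x)) 0 :=
    hd.hasFDerivAt.hasLineDerivAt (y - x)
  have h2 := h1.hasDerivWithinAt (s := Ioi 0)
  rw [hasDerivWithinAt_iff_tendsto_slope' (by simp)] at h2
  have h3 : u y - u x ≤ fderiv ℝ u x (y - x) := by
    refine ge_of_tendsto h2 ?_
    filter_upwards [Ioo_mem_nhdsGT (zero_lt_one' ℝ)] with t ht
    have h4 := hu.2 hx hy (by linarith [ht.2] : 0 ≤ 1 - t) ht.1.le (by ring)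
    have h5 : (1 - t) • x + t • y = x + t • (y - x) := by module
    rw [h5] at h4
    simp only [smul_eq_mul] at h4
    rw [slope_def_field]
    simp only [zero_smul, add_zero, sub_zero]
    rw [le_div_iff₀ ht.1]
    nlinarith
  linarith

lemma exists_supergradient {Ω : Set E2} {u : E2 → ℝ} (hu : ConcaveOn ℝ Ω u) {x : E2}
    (hx : x ∈ interior Ω) : ∃ ξ : E2, ∀ y ∈ Ω, u y ≤ u x + ⟪ξ, y - x⟫ := by
  have hui : ConcaveOn ℝ (interior Ω) u := hu.subset interior_subset hu.1.interior
  have hc : ContinuousOn u (interior Ω) := hu.continuousOn_interior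
  have hA : Convex ℝ {p : E2 × ℝ | p.1 ∈ interior Ω ∧ p.2 < u p.1} := hui.convex_strict_hypograph
  have hAo : IsOpen {p : E2 × ℝ | p.1 ∈ interior Ω ∧ p.2 < u p.1} := by
    rw [isOpen_iff_mem_nhds]
    rintro ⟨p, t⟩ ⟨hp, ht⟩
    have h1 : ContinuousAt (fun q : E2 × ℝ => u q.1) (p, t) :=
      ContinuousAt.comp (f := Prod.fst) (g := u) (hc.continuousAt (isOpen_interior.mem_nhds hp)) continuousAt_fst
    have h2 : ∀ᶠ q : E2 × ℝ in 𝓝 (p, t), q.2 < u q.1 :=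
      continuousAt_snd.eventually_lt h1 ht
    have h3 : ∀ᶠ q : E2 × ℝ in 𝓝 (p, t), q.1 ∈ interior Ω :=
      continuousAt_fst.eventually (isOpen_interior.mem_nhds hp)
    filter_upwards [h2, h3] with q h2 h3 using ⟨h3, h2⟩
  obtain ⟨f, hf⟩ := geometric_hahn_banach_open_point hA hAo (x := (x, u x)) (by simp)
  have hfd : ∀ (y : E2) (t : ℝ), f (y, t) = f (y, 0) + t * f (0, 1) := by
    intro y t
    have : ((y, t) : E2 × ℝ) = (y, 0) + t • ((0, 1) : E2 × ℝ) := by simp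
    rw [this, map_add, map_smul, smul_eq_mul]
  have hc0 : 0 < f (0, 1) := by
    have := hf (x, u x - 1) ⟨hx, by simp⟩
    rw [hfd x (u x - 1), hfd x (u x)] at this
    linarith
  set c := f (0, 1) with hcdef
  let g : E2 →L[ℝ] ℝ := f.comp (ContinuousLinearMap.inl ℝ E2 ℝ)
  refine ⟨(InnerProductSpace.toDual ℝ E2).symm (-(c⁻¹) • g), ?_⟩
  have key : ∀ y ∈ interior Ω, u y ≤ u x + (-(c⁻¹)) * g (y - x) := by
    intro y hy
    have : ∀ t < u y, t ≤ u x + (-(c⁻¹)) * g (y - x) := by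
      intro t ht
      have h1 := hf (y, t) ⟨hy, ht⟩
      rw [hfd y t, hfd x (u x)] at h1
      have h2 : g (y - x) = f (y, 0) - f (x, 0) := by
        simp [g, ← map_sub]
      rw [h2]
      have h3 : t * c < u x * c - (f (y, 0) - f (x, 0)) := by linarith
      have h4 : t < (u x * c - (f (y, 0) - f (x, 0))) / c := by rwa [lt_div_iff₀ hc0]
      have h5 : (u x * c - (f (y, 0) - f (x, 0))) / c = u x + (-(c⁻¹)) * (f (y, 0) - f (x, 0)) := by
        field_simp
        ring
      linarith
    exact le_of_forall_lt_imp_le_of_dense this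
  intro y hy
  have hm : (1/2 : ℝ) • x + (1/2 : ℝ) • y ∈ interior Ω :=
    hu.1.combo_interior_self_mem_interior hx hy (by norm_num) (by norm_num) (by norm_num)
  have h1 := key _ hm
  have h2 := hu.2 (interior_subset hx) hy (by norm_num : (0:ℝ) ≤ 1/2) (by norm_num : (0:ℝ) ≤ 1/2) (by norm_num)
  have h3 : (1/2 : ℝ) • x + (1/2 : ℝ) • y - x = (1/2 : ℝ) • (y - x) := by module
  rw [h3, map_smul] at h1
  simp only [smul_eq_mul] at h1 h2
  have h4 : ⟪(InnerProductSpace.toDual ℝ E2).symm (-(c⁻¹) • g), y - x⟫ = -(c⁻¹) * g (y - x) := by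
    rw [InnerProductSpace.toDual_symm_apply]; simp
  rw [h4]
  linarith

lemma ae_diff {Ω : Set E2} {u : E2 → ℝ} (hu : ConcaveOn ℝ Ω u) :
    ∀ᵐ x ∂(volume : Measure E2), x ∈ interior Ω → DifferentiableAt ℝ u x := by
  have hl := hu.locallyLipschitzOn_interior
  have : volume {x : E2 | x ∈ interior Ω ∧ ¬ DifferentiableAt ℝ u x} = 0 := by
    refine measure_null_of_locally_null _ ?_
    rintro x ⟨hx, -⟩
    obtain ⟨K, t, ht, hK⟩ := hl hx
    rw [isOpen_interior.nhdsWithin_eq hx] at ht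
    obtain ⟨t', ht', hto, hxt⟩ := mem_nhds_iff.1 ht
    refine ⟨t' ∩ {x : E2 | x ∈ interior Ω ∧ ¬ DifferentiableAt ℝ u x}, ?_, ?_⟩
    · exact inter_mem (mem_nhdsWithin_of_mem_nhds (hto.mem_nhds hxt)) self_mem_nhdsWithin
    · have h1 := (hK.mono ht').ae_differentiableWithinAt_of_mem (μ := volume)
      rw [ae_iff] at h1
      refine measure_mono_null ?_ h1
      rintro y ⟨hy, -, hyd⟩ hcon
      exact hyd ((hcon hy).differentiableAt (hto.mem_nhds hy))
  rw [ae_iff]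
  refine measure_mono_null ?_ this
  intro x hx
  simpa using hx

lemma one_le_norm_gradient {φ : E2 → ℝ} {x : E2} (hd : DifferentiableAt ℝ φ x) {U : Set E2}
    (hU : U ∈ 𝓝 x)
    (h : ∀ η > 0, ∃ ξ : E2, 1 ≤ ‖ξ‖ ∧ ∀ y ∈ U, φ y ≤ φ x + η + ⟪ξ, y - x⟫) :
    1 ≤ ‖gradient φ x‖ := by
  by_contra hlt
  push Not at hlt
  set g := gradient φ x with hg
  set ρ := (1 - ‖g‖) / 4 with hρ
  have hρ0 : 0 < ρ := by rw [hρ]; linarith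
  have h1 := hd.hasFDerivAt.isLittleO.def hρ0
  obtain ⟨r, hr, hball⟩ := Metric.eventually_nhds_iff_ball.1 (h1.and hU)
  obtain ⟨ξ, hξ, hy⟩ := h (ρ * (r / 2)) (by positivity)
  have hne : 0 < ‖ξ - g‖ := by
    have := norm_sub_norm_le ξ g
    linarith
  set y := x - (r / 2 / ‖ξ - g‖) • (ξ - g) with hydef
  have hyx : y - x = -((r / 2 / ‖ξ - g‖) • (ξ - g)) := by rw [hydef]; abel
  have hn : ‖y - x‖ = r / 2 := by
    rw [hyx, norm_neg, norm_smul, Real.norm_of_nonneg (by positivity)]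
    field_simp
  have hyb : y ∈ Metric.ball x r := by
    rw [mem_ball_iff_norm, hn]; linarith
  obtain ⟨h2, h3⟩ := hball y hyb
  have h4 := hy y h3
  rw [← inner_gradient_eq, ← hg, hn, Real.norm_eq_abs, abs_le] at h2
  have h5 : ⟪ξ, y - x⟫ - ⟪g, y - x⟫ = - (r / 2 * ‖ξ - g‖) := by
    rw [← inner_sub_left, hyx, inner_neg_right, inner_smul_right, real_inner_self_eq_norm_sq]
    field_simp
  have h6 : r / 2 * ‖ξ - g‖ ≤ r / 2 * (2 * ρ) := by linarith [h2.1]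
  have h7 : ‖ξ - g‖ ≤ 2 * ρ := le_of_mul_le_mul_left h6 (by positivity)
  have := norm_sub_norm_le ξ g
  linarith

lemma gradient_eq_of_le {u v : E2 → ℝ} {x : E2} (hu : DifferentiableAt ℝ u x)
    (hv : DifferentiableAt ℝ v x) (h : ∀ᶠ y in 𝓝 x, u y ≤ v y) (hx : u x = v x) :
    gradient u x = gradient v x := by
  have h1 : IsLocalMin (fun y => v y - u y) x := by
    filter_upwards [h] with y hy
    linarith
  have h2 := h1.fderiv_eq_zero
  have h3 : fderiv ℝ (fun y => v y - u y) x = fderiv ℝ v x - fderiv ℝ u x := fderiv_fun_sub hv hu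
  rw [h3, sub_eq_zero] at h2
  simp [gradient, h2]

lemma meas_gradient (u : E2 → ℝ) : Measurable (gradient u) := by
  unfold gradient
  exact (LinearIsometryEquiv.continuous _).measurable.comp (measurable_fderiv ℝ u)

/-- If `|∇u| ≥ 1` at a.e. interior point with `u < M`, then at every differentiability point. -/
lemma one_le_of_ae {Ω : Set E2} {u : E2 → ℝ} {M : ℝ} (hu : ConcaveOn ℝ Ω u) 
    (hne : (interior Ω).Nonempty)
    (hae : ∀ᵐ x ∂(volume : Measure E2), x ∈ interior Ω → u x < M → 1 ≤ ‖gradient u x‖)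
    {p : E2} (hp : p ∈ Ω) (hd : DifferentiableAt ℝ u p) (hpM : u p < M) :
    1 ≤ ‖gradient u p‖ := by
  by_contra hlt
  push Not at hlt
  set g := gradient u p with hg
  obtain ⟨z, hz⟩ := hne
  obtain ⟨r, hr, hzr⟩ := Metric.isOpen_iff.1 isOpen_interior z hz
  set C := ‖z - p‖ + r with hC
  have hC0 : 0 < C := by positivity
  set ρ := (1 - ‖g‖) * r / (8 * C) with hρ
  have hρ0 : 0 < ρ := by rw [hρ]; have : 0 < 1 - ‖g‖ := by linarith
                         positivity
  have h1 := hd.hasFDerivAt.isLittleO.def hρ0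
  have hcont : ∀ᶠ y in 𝓝 p, u y < M := hd.continuousAt.eventually_lt continuousAt_const hpM
  obtain ⟨s, hs, hball⟩ := Metric.eventually_nhds_iff_ball.1 (h1.and hcont)
  set l := min (1/2) (s / (2 * C)) with hl
  have hl0 : 0 < l := by rw [hl]; positivity
  have hl1 : l < 1 := lt_of_le_of_lt (min_le_left _ _) (by norm_num)
  have hls : l * C < s := by
    have : l ≤ s / (2 * C) := min_le_right _ _
    calc l * C ≤ s / (2 * C) * C := by gcongr
      _ = s / 2 := by field_simp
      _ < s := by linarith
  set c := p + l • (z - p) with hc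
  -- ball around c inside Ω
  have hsub : Metric.ball c (l * r) ⊆ interior Ω := by
    intro y hy
    have h2 : z + l⁻¹ • (y - c) ∈ interior Ω := by
      apply hzr
      rw [mem_ball_iff_norm] at hy ⊢
      rw [add_sub_cancel_left, norm_smul, norm_inv, Real.norm_of_nonneg hl0.le, inv_mul_lt_iff₀ hl0]
      exact hy
    have h3 := hu.1.combo_self_interior_mem_interior hp h2 (by linarith : 0 ≤ 1 - l) hl0 (by ring)
    have h4 : (1 - l) • p + l • (z + l⁻¹ • (y - c)) = y := by
      rw [smul_add, smul_smul, mul_inv_cancel₀ hl0.ne', one_smul, hc]; module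
    rwa [h4] at h3
  have hpos : 0 < volume (Metric.ball c (l * r / 2)) := Metric.measure_ball_pos _ _ (by positivity)
  obtain ⟨x, hxb, hx1, hx2⟩ : ∃ x ∈ Metric.ball c (l * r / 2),
      (x ∈ interior Ω → DifferentiableAt ℝ u x) ∧
      (x ∈ interior Ω → u x < M → 1 ≤ ‖gradient u x‖) := by
    by_contra hcon
    push Not at hcon
    have h0 := (ae_diff hu).and hae
    rw [ae_iff] at h0
    refine hpos.ne' (measure_mono_null ?_ h0)
    intro x hx hh
    obtain ⟨h3, h4, h5⟩ := hcon x hx hh.1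
    exact absurd (hh.2 h3 h4) (not_le.2 h5)
  have near : ∀ y ∈ Metric.ball c (l * r), ‖y - p‖ ≤ l * C := by
    intro y hy
    rw [mem_ball_iff_norm] at hy
    have : y - p = (y - c) + l • (z - p) := by rw [hc]; abel
    rw [this]
    refine (norm_add_le _ _).trans ?_
    rw [norm_smul, Real.norm_of_nonneg hl0.le, hC]
    nlinarith
  have hxb' : x ∈ Metric.ball c (l * r) := Metric.ball_subset_ball (by nlinarith) hxb
  have hxi := hsub hxb'
  have inb : ∀ y ∈ Metric.ball c (l * r), y ∈ Metric.ball p s := by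
    intro y hy
    rw [mem_ball_iff_norm]
    exact lt_of_le_of_lt (near y hy) hls
  have hxM := (hball x (inb x hxb')).2
  have hξ := hx2 hxi hxM
  have hdx := hx1 hxi
  set ξ := gradient u x with hξdef
  have hneξ : 0 < ‖ξ - g‖ := by
    have := norm_sub_norm_le ξ g
    linarith
  set y := x - (l * r / 2 / ‖ξ - g‖) • (ξ - g) with hydef
  have hyx : y - x = -((l * r / 2 / ‖ξ - g‖) • (ξ - g)) := by rw [hydef]; abel
  have hn : ‖y - x‖ = l * r / 2 := by
    rw [hyx, norm_neg, norm_smul, Real.norm_of_nonneg (by positivity)]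
    field_simp
  have hyb : y ∈ Metric.ball c (l * r) := by
    rw [mem_ball_iff_norm] at hxb ⊢
    have : y - c = (y - x) + (x - c) := by abel
    rw [this]
    refine lt_of_le_of_lt (norm_add_le _ _) ?_
    linarith
  have h4 := support_of_diff hu (interior_subset hxi) (interior_subset (hsub hyb)) hdx
  have h2y := (hball y (inb y hyb)).1
  have h2x := (hball x (inb x hxb')).1
  rw [← inner_gradient_eq, ← hg, Real.norm_eq_abs, abs_le] at h2y h2x
  have ny := near y hyb
  have nx := near x hxb'
  have h5 : ⟪ξ, y - x⟫ - ⟪g, y - x⟫ = - (l * r / 2 * ‖ξ - g‖) := by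
    rw [← inner_sub_left, hyx, inner_neg_right, inner_smul_right, real_inner_self_eq_norm_sq]
    field_simp
  have h6 : ⟪g, y - x⟫ = ⟪g, y - p⟫ - ⟪g, x - p⟫ := by rw [← inner_sub_right]; congr 1; abel
  have h7 : l * r / 2 * ‖ξ - g‖ ≤ 2 * (ρ * (l * C)) := by
    have e1 : ρ * ‖y - p‖ ≤ ρ * (l * C) := by gcongr
    have e2 : ρ * ‖x - p‖ ≤ ρ * (l * C) := by gcongr
    rw [← hξdef] at h4
    linarith [h2y.1, h2x.2]
  have h8 : 2 * (ρ * (l * C)) = l * r / 2 * ((1 - ‖g‖) / 2) := by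
    rw [hρ]; field_simp; ring
  rw [h8] at h7
  have h9 := le_of_mul_le_mul_left h7 (by positivity)
  have := norm_sub_norm_le ξ g
  linarith

lemma concave_ac {a b c d : ℝ} {φ : ℝ → ℝ} (hφ : ConcaveOn ℝ (Ioo a b) φ) (hc : a < c)
    (hcd : c ≤ d) (hd : d < b) : AbsolutelyContinuousOnInterval φ c d := by
  have h1 : LocallyLipschitzOn (Icc c d) φ :=
    (hφ.locallyLipschitzOn isOpen_Ioo).mono (fun x hx => ⟨hc.trans_le hx.1, hx.2.trans_lt hd⟩)
  obtain ⟨K, hK⟩ := h1.exists_lipschitzOnWith_of_compact isCompact_Icc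
  rw [← uIcc_of_le hcd] at hK
  exact hK.absolutelyContinuousOnInterval

lemma lintegral_abs_deriv_low {ψ : ℝ → ℝ} {c d : ℝ} (hcd : c ≤ d)
    (h : AbsolutelyContinuousOnInterval ψ c d) :
    ENNReal.ofReal |ψ d - ψ c| ≤ ∫⁻ x in Ioc c d, ENNReal.ofReal |deriv ψ x| := by
  have h1 := h.integral_deriv_eq_sub
  have h2 := h.intervalIntegrable_deriv
  rw [intervalIntegrable_iff_integrableOn_Ioc_of_le hcd] at h2
  rw [← h1, intervalIntegral.integral_of_le hcd, ← ofReal_integral_eq_lintegral_ofReal h2.abs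
    (ae_of_all _ fun x => abs_nonneg _)]
  exact ENNReal.ofReal_le_ofReal abs_integral_le_integral_abs

lemma lintegral_abs_deriv_mono {φ : ℝ → ℝ} {c d : ℝ} (hcd : c ≤ d)
    (h : AbsolutelyContinuousOnInterval φ c d) (hm : MonotoneOn φ (Icc c d)) :
    ∫⁻ x in Ioc c d, ENNReal.ofReal |deriv φ x| = ENNReal.ofReal (φ d - φ c) := by
  have h1 := h.integral_deriv_eq_sub
  have h2 := h.intervalIntegrable_deriv
  rw [intervalIntegrable_iff_integrableOn_Ioc_of_le hcd] at h2
  have h3 : ∀ x ∈ Ioo c d, 0 ≤ deriv φ x := by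
    intro x hx
    have : derivWithin φ (Icc c d) x = deriv φ x :=
      derivWithin_of_mem_nhds (Icc_mem_nhds hx.1 hx.2)
    rw [← this]
    exact hm.derivWithin_nonneg
  rw [restrict_Ioo_eq_restrict_Ioc.symm]
  have h4 : ∀ᵐ x ∂(volume.restrict (Ioo c d)), 0 ≤ deriv φ x :=
    (ae_restrict_iff' measurableSet_Ioo).2 (ae_of_all _ h3)
  rw [← h1, intervalIntegral.integral_of_le hcd, restrict_Ioo_eq_restrict_Ioc.symm]
  rw [ofReal_integral_eq_lintegral_ofReal (h2.mono_set Ioo_subset_Ioc_self) h4]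
  refine lintegral_congr_ae ?_
  filter_upwards [h4] with x hx
  rw [abs_of_nonneg hx]

lemma lintegral_abs_deriv_up {a b c d : ℝ} {φ : ℝ → ℝ} (hφ : ConcaveOn ℝ (Ioo a b) φ) (hc : a < c)
    (hcd : c ≤ d) (hd : d < b) : ∃ x ∈ Icc c d,
    ∫⁻ x in Ioc c d, ENNReal.ofReal |deriv φ x| ≤ ENNReal.ofReal (2 * φ x - φ c - φ d) := by
  have hsub : Icc c d ⊆ Ioo a b := fun x hx => ⟨hc.trans_le hx.1, hx.2.trans_lt hd⟩
  have hcont : ContinuousOn φ (Icc c d) := (hφ.continuousOn isOpen_Ioo).mono hsub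
  obtain ⟨x, hx, hmax⟩ := isCompact_Icc.exists_isMaxOn (nonempty_Icc.2 hcd) hcont
  refine ⟨x, hx, ?_⟩
  have hmon : MonotoneOn φ (Icc c x) := by
    intro s hs t ht hst
    have h1 := hφ.ge_on_segment (hsub ⟨hs.1, hs.2.trans hx.2⟩) (hsub hx)
      (z := t) (by rw [segment_eq_Icc (hst.trans ht.2)]; exact ⟨hst, ht.2⟩)
    rwa [min_eq_left (hmax ⟨hs.1, hs.2.trans hx.2⟩)] at h1
  have hanti : MonotoneOn (fun t => - φ t) (Icc x d) := by
    intro s hs t ht hst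
    have h1 := hφ.ge_on_segment (hsub hx) (hsub ⟨hx.1.trans ht.1, ht.2⟩)
      (z := s) (by rw [segment_eq_Icc (hs.1.trans hst)]; exact ⟨hs.1, hst⟩)
    rw [min_eq_right (hmax ⟨hx.1.trans ht.1, ht.2⟩)] at h1
    simpa using h1
  have e1 := lintegral_abs_deriv_mono hx.1 (concave_ac hφ hc hx.1 (hx.2.trans_lt hd)) hmon
  have e2 := lintegral_abs_deriv_mono hx.2 (concave_ac hφ (hc.trans_le hx.1) hx.2 hd).neg hanti
  have e3 : ∀ t, deriv (-φ) t = - deriv φ t := fun t => deriv.neg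
  simp only [e3, abs_neg, Pi.neg_apply] at e2
  rw [← Ioc_union_Ioc_eq_Ioc hx.1 hx.2, lintegral_union measurableSet_Ioc
    (Ioc_disjoint_Ioc_of_le le_rfl), e1, e2, ← ENNReal.ofReal_add]
  · apply ENNReal.ofReal_le_ofReal; linarith
  · have : φ c ≤ φ x := hmax (left_mem_Icc.2 hcd)
    linarith
  · have : φ d ≤ φ x := hmax (right_mem_Icc.2 hcd)
    linarith

lemma line_le {a b K Δ : ℝ} {φ ψ : ℝ → ℝ} (hφ : ConcaveOn ℝ (Ioo a b) φ)
    (hψ : ConcaveOn ℝ (Ioo a b) ψ) (hK : ∀ x ∈ Ioo a b, ψ x ≤ K)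
    (hΔ : ∀ x ∈ Ioo a b, ∃ y ∈ Ioo a b, φ x ≤ ψ y + Δ)
    (ha : ∀ η > 0, ∀ᶠ x in 𝓝[>] a, ψ x ≤ φ x + η)
    (hb : ∀ η > 0, ∀ᶠ x in 𝓝[<] b, ψ x ≤ φ x + η) :
    ∫⁻ x in Ioo a b, ENNReal.ofReal |deriv φ x| ≤
      (∫⁻ x in Ioo a b, ENNReal.ofReal |deriv ψ x|) + ENNReal.ofReal (2 * Δ) := by
  rcases le_or_gt b a with hab | hab
  · simp [Ioo_eq_empty_of_le hab]
  set R := (∫⁻ x in Ioo a b, ENNReal.ofReal |deriv ψ x|) + ENNReal.ofReal (2 * Δ) with hR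
  have key : ∀ c d, a < c → c ≤ d → d < b → ∫⁻ x in Ioc c d, ENNReal.ofReal |deriv φ x| ≤ R := by
    intro c d hc hcd hd
    apply ENNReal.le_of_forall_pos_le_add
    intro η hη _
    have hη' : (0:ℝ) < η := hη
    -- near-sup of ψ
    obtain ⟨y, hy, hysup⟩ : ∃ y ∈ Ioo a b, ∀ x ∈ Ioo a b, ψ x ≤ ψ y + η / 4 := by
      have hne : (ψ '' Ioo a b).Nonempty := (nonempty_Ioo.2 hab).image _
      have hbd : BddAbove (ψ '' Ioo a b) := ⟨K, by rintro _ ⟨x, hx, rfl⟩; exact hK x hx⟩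
      obtain ⟨_, ⟨y, hy, rfl⟩, hlt⟩ := exists_lt_of_lt_csSup hne
        (show sSup (ψ '' Ioo a b) - η / 4 < _ by linarith)
      exact ⟨y, hy, fun x hx => by linarith [le_csSup hbd (mem_image_of_mem ψ hx)]⟩
    obtain ⟨c', hc'1, hc'2, hc'3⟩ := ((ha (η/4) (by positivity)).and
      (Ioo_mem_nhdsGT (lt_min hc hy.1))).exists
    obtain ⟨d', hd'1, hd'2, hd'3⟩ := ((hb (η/4) (by positivity)).and
      (Ioo_mem_nhdsLT (max_lt hd hy.2))).exists
    have l1 : c' < c := hc'3.trans_le (min_le_left _ _)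
    have l2 : c' < y := hc'3.trans_le (min_le_right _ _)
    have l3 : d < d' := (le_max_left _ _).trans_lt hd'2
    have l4 : y < d' := (le_max_right _ _).trans_lt hd'2
    obtain ⟨x, hx, hup⟩ := lintegral_abs_deriv_up hφ hc'2 (l2.trans l4).le hd'3
    have hxI : x ∈ Ioo a b := ⟨hc'2.trans_le hx.1, hx.2.trans_lt hd'3⟩
    obtain ⟨y', hy', hxy'⟩ := hΔ x hxI
    have hxy : φ x ≤ ψ y + η / 4 + Δ := by linarith [hysup y' hy']
    have low1 := lintegral_abs_deriv_low l2.le (concave_ac hψ hc'2 l2.le hy.2)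
    have low2 := lintegral_abs_deriv_low l4.le (concave_ac hψ hy.1 l4.le hd'3)
    calc ∫⁻ x in Ioc c d, ENNReal.ofReal |deriv φ x|
        ≤ ∫⁻ x in Ioc c' d', ENNReal.ofReal |deriv φ x| :=
          lintegral_mono_set (Ioc_subset_Ioc l1.le l3.le)
      _ ≤ ENNReal.ofReal (2 * φ x - φ c' - φ d') := hup
      _ ≤ ENNReal.ofReal ((|ψ y - ψ c'| + |ψ d' - ψ y|) + 2 * Δ + η) := by
          apply ENNReal.ofReal_le_ofReal
          have := le_abs_self (ψ y - ψ c')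
          have := neg_abs_le (ψ d' - ψ y)
          linarith
      _ ≤ ENNReal.ofReal |ψ y - ψ c'| + ENNReal.ofReal |ψ d' - ψ y| + ENNReal.ofReal (2 * Δ)
            + ENNReal.ofReal η := by
          refine (ENNReal.ofReal_add_le).trans ?_
          gcongr
          refine (ENNReal.ofReal_add_le).trans ?_
          gcongr
          exact ENNReal.ofReal_add_le
      _ ≤ R + η := by
          rw [ENNReal.ofReal_coe_nnreal, hR]
          gcongr
          refine (add_le_add low1 low2).trans ?_
          rw [← lintegral_union measurableSet_Ioc (Ioc_disjoint_Ioc_of_le le_rfl),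
            Ioc_union_Ioc_eq_Ioc l2.le l4.le]
          exact lintegral_mono_set (fun t ht => ⟨hc'2.trans ht.1, ht.2.trans_lt hd'3⟩)
  obtain ⟨cs, cs1, cs2, cs3⟩ := exists_seq_strictAnti_tendsto' (show a < (a + b) / 2 by linarith)
  obtain ⟨ds, ds1, ds2, ds3⟩ := exists_seq_strictMono_tendsto' (show (a + b) / 2 < b by linarith)
  have hU : Ioo a b ⊆ ⋃ n, Ioc (cs n) (ds n) := by
    intro x hx
    have h1 := cs3.eventually_lt_const hx.1
    have h2 := ds3.eventually_const_lt hx.2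
    obtain ⟨n, h1, h2⟩ := (h1.and h2).exists
    exact mem_iUnion.2 ⟨n, h1, h2.le⟩
  refine (lintegral_mono_set hU).trans ?_
  rw [setLIntegral_iUnion_of_directed]
  · refine iSup_le fun n => key _ _ (cs2 n).1 ?_ (ds2 n).2
    exact ((cs2 n).2.trans (ds2 n).1).le
  · exact directed_of_isDirected_le fun m n hmn => 
      Ioc_subset_Ioc (cs1.antitone hmn) (ds1.monotone hmn)

lemma frame_mp {e e' : E2} (h1 : ‖e‖ = 1) (h2 : ‖e'‖ = 1) (h3 : ⟪e', e⟫ = 0) :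
    ∃ ψ : ℝ × ℝ ≃ᵐ E2, MeasurePreserving ψ volume volume ∧
      (∀ p, ψ p = p.1 • e' + p.2 • e) := by
  have hon : Orthonormal ℝ ![e', e] := by
    rw [orthonormal_iff_ite]
    intro i j
    fin_cases i <;> fin_cases j <;> simp [h1, h2, h3, real_inner_comm e' e]
  let b0 : Module.Basis (Fin 2) ℝ E2 := basisOfOrthonormalOfCardEqFinrank hon (by simp)
  have hb0 : ⇑b0 = ![e', e] := coe_basisOfOrthonormalOfCardEqFinrank hon (by simp)
  let b : OrthonormalBasis (Fin 2) ℝ E2 := b0.toOrthonormalBasis (by rw [hb0]; exact hon)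
  have hb : ⇑b = ![e', e] := by simp [b, hb0]
  refine ⟨(MeasurableEquiv.finTwoArrow (α := ℝ)).symm.trans
    ((MeasurableEquiv.toLp 2 (Fin 2 → ℝ)).trans b.repr.toHomeomorph.toMeasurableEquiv.symm), ?_, ?_⟩
  · have m1 := (volume_preserving_finTwoArrow ℝ).symm
    have m2 := (EuclideanSpace.volume_preserving_symm_measurableEquiv_toLp (Fin 2)).symm
    have m3 := b.measurePreserving_repr_symm
    exact m3.comp (m2.comp m1)
  · intro p
    show b.repr.symm (WithLp.toLp 2 (![p.1, p.2])) = _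
    rw [← b.sum_repr_symm]
    simp [hb]

lemma slice_Ioo {T : Set ℝ} (ho : IsOpen T) (hc : T.OrdConnected) (hb : Bornology.IsBounded T)
    (hne : T.Nonempty) : ∃ a b, a < b ∧ T = Ioo a b := by
  have h1 := hb.bddBelow
  have h2 := hb.bddAbove
  have hT : T = Ioo (sInf T) (sSup T) := by
    refine Subset.antisymm ?_ ?_
    · intro x hx
      obtain ⟨l, r, hlr, hs⟩ := mem_nhds_iff_exists_Ioo_subset.1 (ho.mem_nhds hx)
      obtain ⟨y, hy1, hy2⟩ := exists_between hlr.1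
      obtain ⟨z, hz1, hz2⟩ := exists_between hlr.2
      exact ⟨(csInf_le h1 (hs ⟨hy1, hy2.trans hlr.2⟩)).trans_lt hy2,
        hz1.trans_le (le_csSup h2 (hs ⟨hlr.1.trans hz1, hz2⟩))⟩
    · intro x hx
      obtain ⟨y, hy, hyx⟩ := exists_lt_of_csInf_lt hne hx.1
      obtain ⟨z, hz, hzx⟩ := exists_lt_of_lt_csSup hne hx.2
      exact hc.out hy hz ⟨hyx.le, hzx.le⟩
  obtain ⟨x, hx⟩ := hne
  refine ⟨sInf T, sSup T, ?_, hT⟩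
  rw [hT] at hx
  exact hx.1.trans hx.2

lemma crofton_dir {Ω : Set E2} {u v : E2 → ℝ} {K d : ℝ} (hΩ : IsConvexBody2 Ω)
    (hu : ConcaveOn ℝ Ω u) (hv : ConcaveOn ℝ Ω v) (hK : ∀ x ∈ Ω, v x ≤ K)
    (hi : ∀ x ∈ interior Ω, ∀ b ∈ frontier Ω, v x ≤ u x + 2 * ‖x - b‖)
    {e e' : E2} (h1 : ‖e‖ = 1) (h2 : ‖e'‖ = 1) (h3 : ⟪e', e⟫ = 0) (B : Set ℝ)
    (hB : ∀ x ∈ interior Ω, ⟪x, e'⟫ ∉ B → ∃ y ∈ interior Ω, ⟪y, e'⟫ = ⟪x, e'⟫ ∧ u x ≤ v y)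
    (hB2 : ∀ x ∈ interior Ω, ∃ y ∈ interior Ω, ⟪y, e'⟫ = ⟪x, e'⟫ ∧ u x ≤ v y + d) :
    ∫⁻ x in interior Ω, ENNReal.ofReal |⟪gradient u x, e⟫| ≤
      (∫⁻ x in interior Ω, ENNReal.ofReal |⟪gradient v x, e⟫|) +
        ENNReal.ofReal (2 * d) * volume B := by
  obtain ⟨ψ, hψ, hψe⟩ := frame_mp h1 h2 h3
  have hmeas : ∀ w : E2 → ℝ, Measurable ((interior Ω).indicator
      (fun x => ENNReal.ofReal |⟪gradient w x, e⟫|)) := by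
    intro w
    refine Measurable.indicator ?_ isOpen_interior.measurableSet
    have := meas_gradient w
    exact ENNReal.measurable_ofReal.comp ((this.inner measurable_const).abs)
  have key : ∀ w : E2 → ℝ, ∫⁻ x in interior Ω, ENNReal.ofReal |⟪gradient w x, e⟫| =
      ∫⁻ s : ℝ, ∫⁻ t : ℝ, (interior Ω).indicator
        (fun x => ENNReal.ofReal |⟪gradient w x, e⟫|) (ψ (s, t)) := by
    intro w
    rw [← lintegral_indicator isOpen_interior.measurableSet, ← hψ.lintegral_comp (hmeas w),
      Measure.volume_eq_prod]
    exact lintegral_prod _ ((hmeas w).comp ψ.measurable).aemeasurable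
  have hin : ∀ s t, ⟪ψ (s, t), e'⟫ = s := by
    intro s t
    rw [hψe, inner_add_left, inner_smul_left, inner_smul_left, real_inner_self_eq_norm_sq, h2,
      real_inner_comm, h3]
    simp
  have hsurj : ∀ y s, ⟪y, e'⟫ = s → ∃ t, ψ (s, t) = y := by
    intro y s hy
    obtain ⟨⟨s', t⟩, rfl⟩ := ψ.surjective y
    rw [hin] at hy
    exact ⟨t, by rw [hy]⟩
  have hae : ∀ᵐ s : ℝ, ∀ᵐ t : ℝ, ψ (s, t) ∈ interior Ω →
      DifferentiableAt ℝ u (ψ (s, t)) ∧ DifferentiableAt ℝ v (ψ (s, t)) := by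
    have : ∀ᵐ p : ℝ × ℝ, ψ p ∈ interior Ω →
      DifferentiableAt ℝ u (ψ p) ∧ DifferentiableAt ℝ v (ψ p) := by
      refine hψ.quasiMeasurePreserving.ae (p := fun x => x ∈ interior Ω →
        DifferentiableAt ℝ u x ∧ DifferentiableAt ℝ v x) ?_
      filter_upwards [ae_diff hu, ae_diff hv] with x a b hx using ⟨a hx, b hx⟩
    rw [Measure.volume_eq_prod] at this
    exact Measure.ae_ae_of_ae_prod this
  rw [key u, key v]
  have hmv : Measurable (fun s : ℝ => ∫⁻ t : ℝ, (interior Ω).indicator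
        (fun x => ENNReal.ofReal |⟪gradient v x, e⟫|) (ψ (s, t))) :=
    ((hmeas v).comp ψ.measurable).lintegral_prod_right'
  refine le_trans ?_ (add_le_add_right (lintegral_indicator_const_le B (ENNReal.ofReal (2 * d))) _)
  rw [← lintegral_add_left hmv]
  refine lintegral_mono_ae ?_
  filter_upwards [hae] with s hs
  set T : Set ℝ := {t | ψ (s, t) ∈ interior Ω} with hT
  have hcont : Continuous (fun t : ℝ => ψ (s, t)) := by
    simp only [hψe]; fun_prop
  have hTo : IsOpen T := isOpen_interior.preimage hcont
  have hTind : ∀ w : E2 → ℝ, (∀ᵐ t : ℝ, ψ (s, t) ∈ interior Ω → DifferentiableAt ℝ w (ψ (s, t))) →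
      ∫⁻ t : ℝ, (interior Ω).indicator
        (fun x => ENNReal.ofReal |⟪gradient w x, e⟫|) (ψ (s, t)) =
      ∫⁻ t in T, ENNReal.ofReal |deriv (fun t => w (ψ (s, t))) t| := by
    intro w hw
    rw [← lintegral_indicator hTo.measurableSet]
    refine lintegral_congr_ae ?_
    filter_upwards [hw] with t ht
    by_cases hmem : ψ (s, t) ∈ interior Ω
    · rw [indicator_of_mem hmem, indicator_of_mem (show t ∈ T from hmem)]
      have hd := (ht hmem).hasFDerivAt
      have hl : HasDerivAt (fun t : ℝ => ψ (s, t)) e t := by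
        simp only [hψe]
        simpa using ((hasDerivAt_id t).smul_const e).const_add (s • e')
      have := hd.comp_hasDerivAt t hl
      rw [inner_gradient_eq]
      congr 2
      exact this.deriv.symm
    · rw [indicator_of_notMem hmem, indicator_of_notMem (show t ∉ T from hmem)]
  rw [hTind u (hs.mono fun t ht hm => (ht hm).1), hTind v (hs.mono fun t ht hm => (ht hm).2)]
  rcases T.eq_empty_or_nonempty with hemp | hne
  · rw [hemp]; simp
  have haff : ∀ (a b : ℝ) (t t' : ℝ), a + b = 1 → 
      ψ (s, a * t + b * t') = a • ψ (s, t) + b • ψ (s, t') := by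
    intro a b t t' hab
    simp only [hψe]
    obtain rfl : a = 1 - b := by linarith
    module
  have hTc : Convex ℝ T := by
    intro t ht t' ht' a b ha hb hab
    show ψ (s, a * t + b * t') ∈ interior Ω
    rw [haff a b t t' hab]
    exact hΩ.2.1.interior ht ht' ha hb hab
  have hTb : Bornology.IsBounded T := by
    obtain ⟨R, hR⟩ := hΩ.1.isBounded.exists_norm_le
    rw [isBounded_iff_forall_norm_le]
    refine ⟨R, fun t ht => ?_⟩
    have ht' := hR _ (interior_subset ht)
    have : ⟪ψ (s, t), e⟫ = t := by
      rw [hψe, inner_add_left, inner_smul_left, inner_smul_left, real_inner_self_eq_norm_sq, h1,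
        h3]
      simp
    rw [← this]
    calc ‖⟪ψ (s, t), e⟫‖ ≤ ‖ψ (s, t)‖ * ‖e‖ := norm_inner_le_norm _ _
      _ ≤ R := by rw [h1, mul_one]; exact ht'
  obtain ⟨a, b, hab, hTab⟩ := slice_Ioo hTo hTc.ordConnected hTb hne
  have hconc : ∀ w : E2 → ℝ, ConcaveOn ℝ Ω w → ConcaveOn ℝ (Ioo a b) (fun t => w (ψ (s, t))) := by
    intro w hw
    rw [← hTab]
    refine ⟨hTc, fun t ht t' ht' a b ha hb hab => ?_⟩
    show _ ≤ w (ψ (s, a * t + b * t'))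
    rw [haff a b t t' hab]
    exact hw.2 (interior_subset ht) (interior_subset ht') ha hb hab
  have hfr : ∀ c, c ∈ closure (Ioo a b) → c ∉ Ioo a b → ψ (s, c) ∈ frontier Ω := by
    intro c hc hc'
    rw [← hTab] at hc hc'
    refine ⟨?_, hc'⟩
    have : MapsTo (fun t => ψ (s, t)) T (Ω) := fun t ht => interior_subset ht
    exact this.closure hcont hc
  rw [closure_Ioo hab.ne] at hfr
  have hdist : ∀ t c : ℝ, ‖ψ (s, t) - ψ (s, c)‖ = |t - c| := by
    intro t c
    simp only [hψe]
    rw [add_sub_add_left_eq_sub, ← sub_smul, norm_smul, h1, mul_one, Real.norm_eq_abs]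
  have hends : ∀ (c : ℝ) (hc : ψ (s, c) ∈ frontier Ω) (η : ℝ), 0 < η → ∀ᶠ t in 𝓝 c,
      t ∈ T → v (ψ (s, t)) ≤ u (ψ (s, t)) + η := by
    intro c hc η hη
    filter_upwards [Metric.ball_mem_nhds c (half_pos hη)] with t ht htT
    have := hi _ htT _ hc
    rw [hdist] at this
    rw [Metric.mem_ball, Real.dist_eq] at ht
    linarith
  have hmain : ∀ Δ, (∀ t ∈ T, ∃ t' ∈ T, u (ψ (s, t)) ≤ v (ψ (s, t')) + Δ) →
      ∫⁻ t in T, ENNReal.ofReal |deriv (fun t => u (ψ (s, t))) t| ≤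
      (∫⁻ t in T, ENNReal.ofReal |deriv (fun t => v (ψ (s, t))) t|) + ENNReal.ofReal (2 * Δ) := by
    intro Δ hΔ
    rw [hTab] at hΔ hends ⊢
    refine line_le (K := K) (hconc u hu) (hconc v hv) ?_ hΔ ?_ ?_
    · intro t ht
      rw [← hTab] at ht
      exact hK _ (interior_subset ht)
    · intro η hη
      have := hends a (hfr a ⟨le_rfl, hab.le⟩ (fun h => lt_irrefl _ h.1)) η hη
      filter_upwards [nhdsWithin_le_nhds this, Ioo_mem_nhdsGT hab] with t h1 h2 using h1 h2
    · intro η hη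
      have := hends b (hfr b ⟨hab.le, le_rfl⟩ (fun h => lt_irrefl _ h.2)) η hη
      filter_upwards [nhdsWithin_le_nhds this, Ioo_mem_nhdsLT hab] with t h1 h2 using h1 h2
  by_cases hsB : s ∈ B
  · rw [indicator_of_mem hsB]
    refine hmain d fun t ht => ?_
    obtain ⟨y, hy, hye, hle⟩ := hB2 _ ht
    rw [hin] at hye
    obtain ⟨t', rfl⟩ := hsurj y s hye
    exact ⟨t', hy, hle⟩
  · rw [indicator_of_notMem hsB]
    have := hmain 0 fun t ht => ?_
    · simpa using this
    obtain ⟨y, hy, hye, hle⟩ := hB _ ht (by rwa [hin])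
    rw [hin] at hye
    obtain ⟨t', rfl⟩ := hsurj y s hye
    exact ⟨t', hy, by simpa using hle⟩

/-- The unit vector with polar angle `θ`. -/
def eV (θ : ℝ) : E2 := !₂[Real.cos θ, Real.sin θ]

/-- The unit vector orthogonal to `eV θ`. -/
def eP (θ : ℝ) : E2 := !₂[-Real.sin θ, Real.cos θ]

lemma eV_norm (θ : ℝ) : ‖eV θ‖ = 1 := by
  simp [eV, EuclideanSpace.norm_eq]

lemma eP_norm (θ : ℝ) : ‖eP θ‖ = 1 := by
  simp [eP, EuclideanSpace.norm_eq]

lemma eP_eV (θ : ℝ) : ⟪eP θ, eV θ⟫ = 0 := by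
  simp [eP, eV, PiLp.inner_apply]
  ring

lemma inner_eV (ξ : E2) (θ : ℝ) : ⟪ξ, eV θ⟫ = ξ 0 * Real.cos θ + ξ 1 * Real.sin θ := by
  simp [eV, PiLp.inner_apply]
  ring

/-- The constant in the Crofton formula. -/
def cC : ℝ := ∫ θ in (0:ℝ)..(2 * Real.pi), |Real.cos θ|

lemma cC_pos : 0 < cC := by
  have h1 : ∫ θ in (0:ℝ)..(2 * Real.pi), Real.cos θ ^ 2 ≤ cC := by
    refine intervalIntegral.integral_mono_on Real.two_pi_pos.le
      ((by fun_prop : Continuous fun θ : ℝ => Real.cos θ ^ 2).intervalIntegrable _ _)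
      ((by fun_prop : Continuous fun θ : ℝ => |Real.cos θ|).intervalIntegrable _ _) ?_
    intro x _
    rw [← sq_abs]
    nlinarith [abs_nonneg (Real.cos x), Real.abs_cos_le_one x]
  rw [integral_cos_sq] at h1
  simp at h1
  linarith [Real.pi_pos]

lemma crofton_pt (ξ : E2) : ∫⁻ θ in Ioc (0:ℝ) (2 * Real.pi), ENNReal.ofReal |⟪ξ, eV θ⟫| =
    ENNReal.ofReal cC * ENNReal.ofReal ‖ξ‖ := by
  have hc : Continuous fun θ : ℝ => |⟪ξ, eV θ⟫| := by
    simp only [inner_eV]; fun_prop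
  rw [← ofReal_integral_eq_lintegral_ofReal ?_ (ae_of_all _ fun x => abs_nonneg _),
    ← intervalIntegral.integral_of_le Real.two_pi_pos.le, ← ENNReal.ofReal_mul cC_pos.le]
  · congr 1
    set z : ℂ := ⟨ξ 0, ξ 1⟩ with hz
    have hn : ‖ξ‖ = ‖z‖ := by
      rw [EuclideanSpace.norm_eq, Complex.norm_eq_sqrt_sq_add_sq]
      simp [hz]
    have h0 : ξ 0 = ‖ξ‖ * Real.cos z.arg := by rw [hn, Complex.norm_mul_cos_arg]
    have h1 : ξ 1 = ‖ξ‖ * Real.sin z.arg := by rw [hn, Complex.norm_mul_sin_arg]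
    have : ∀ θ, |⟪ξ, eV θ⟫| = ‖ξ‖ * |Real.cos (θ - z.arg)| := by
      intro θ
      rw [inner_eV, Real.cos_sub]
      conv_rhs => rw [← abs_of_nonneg (norm_nonneg ξ), ← abs_mul]
      congr 1
      have h01 : ‖ξ‖ * (Real.cos θ * Real.cos z.arg + Real.sin θ * Real.sin z.arg) =
        (‖ξ‖ * Real.cos z.arg) * Real.cos θ + (‖ξ‖ * Real.sin z.arg) * Real.sin θ := by ring
      rw [h01, ← h0, ← h1]
    simp only [this]
    rw [intervalIntegral.integral_const_mul, mul_comm]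
    congr 1
    rw [intervalIntegral.integral_comp_sub_right (fun x => |Real.cos x|)]
    have hp : Function.Periodic (fun x => |Real.cos x|) (2 * Real.pi) := by
      intro x; simp
    have := hp.intervalIntegral_add_eq (0 - z.arg) 0
    rw [show 0 - z.arg + 2 * Real.pi = 2 * Real.pi - z.arg by ring, zero_add] at this
    exact this
  · exact (hc.integrableOn_Icc).mono_set Ioc_subset_Icc_self

lemma crofton_int {Ω : Set E2} (w : E2 → ℝ) :
    ∫⁻ θ in Ioc (0:ℝ) (2 * Real.pi), ∫⁻ x in interior Ω, ENNReal.ofReal |⟪gradient w x, eV θ⟫| =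
    ENNReal.ofReal cC * ∫⁻ x in interior Ω, ENNReal.ofReal ‖gradient w x‖ := by
  have hg := meas_gradient w
  rw [lintegral_lintegral_swap]
  · simp only [crofton_pt]
    rw [lintegral_const_mul]
    exact ENNReal.measurable_ofReal.comp hg.norm
  · have : Measurable (Function.uncurry fun (θ : ℝ) (x : E2) => 
        ENNReal.ofReal |⟪gradient w x, eV θ⟫|) := by
      refine ENNReal.measurable_ofReal.comp ?_
      refine Measurable.abs ?_
      refine Measurable.inner (hg.comp measurable_snd) ?_
      have : Continuous eV := by unfold eV; fun_prop
      exact this.measurable.comp measurable_fst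
    exact this.aemeasurable

lemma crofton {Ω : Set E2} {u v : E2 → ℝ} {K d : ℝ} (hΩ : IsConvexBody2 Ω)
    (hu : ConcaveOn ℝ Ω u) (hv : ConcaveOn ℝ Ω v) (hK : ∀ x ∈ Ω, v x ≤ K)
    (hi : ∀ x ∈ interior Ω, ∀ b ∈ frontier Ω, v x ≤ u x + 2 * ‖x - b‖) {m : ℝ} (hd : 0 ≤ d)
    (hB : ∀ e' : E2, ‖e'‖ = 1 → ∃ B : Set ℝ, volume B ≤ ENNReal.ofReal m ∧ 
      ∀ x ∈ interior Ω, ⟪x, e'⟫ ∉ B → ∃ y ∈ interior Ω, ⟪y, e'⟫ = ⟪x, e'⟫ ∧ u x ≤ v y)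
    (hB2 : ∀ e' : E2, ‖e'‖ = 1 → 
      ∀ x ∈ interior Ω, ∃ y ∈ interior Ω, ⟪y, e'⟫ = ⟪x, e'⟫ ∧ u x ≤ v y + d) :
    ∫⁻ x in interior Ω, ENNReal.ofReal ‖gradient u x‖ ≤
      (∫⁻ x in interior Ω, ENNReal.ofReal ‖gradient v x‖) +
        ENNReal.ofReal (4 * Real.pi / cC * d * m) := by
  have hcr : ∀ θ, ∫⁻ x in interior Ω, ENNReal.ofReal |⟪gradient u x, eV θ⟫| ≤
      (∫⁻ x in interior Ω, ENNReal.ofReal |⟪gradient v x, eV θ⟫|) +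
        ENNReal.ofReal (2 * d) * ENNReal.ofReal m := by
    intro θ
    obtain ⟨B, hBm, hB⟩ := hB _ (eP_norm θ)
    refine (crofton_dir hΩ hu hv hK hi (eV_norm θ) (eP_norm θ) (eP_eV θ) B hB
      (hB2 _ (eP_norm θ))).trans ?_
    gcongr
  have h1 : ENNReal.ofReal cC * ∫⁻ x in interior Ω, ENNReal.ofReal ‖gradient u x‖ ≤
      ENNReal.ofReal cC * (∫⁻ x in interior Ω, ENNReal.ofReal ‖gradient v x‖) +
      ENNReal.ofReal (2 * d) * ENNReal.ofReal m * ENNReal.ofReal (2 * Real.pi) := by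
    rw [← crofton_int, ← crofton_int]
    refine (lintegral_mono hcr).trans ?_
    rw [lintegral_add_right _ measurable_const]
    simp
  have hc0 : ENNReal.ofReal cC ≠ 0 := by simpa using cC_pos
  rw [← ENNReal.mul_le_mul_iff_right hc0 ENNReal.ofReal_ne_top, mul_add]
  refine h1.trans (le_of_eq ?_)
  congr 1
  rw [← ENNReal.ofReal_mul (by positivity), ← ENNReal.ofReal_mul cC_pos.le,
    ← ENNReal.ofReal_mul' (by positivity)]
  congr 1
  have := cC_pos.ne'
  field_simp
  ring

lemma exists_normal {Ω : Set E2} (hΩ : IsConvexBody2 Ω) {b : E2} (hb : b ∉ interior Ω) :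
    ∃ n : E2, ‖n‖ = 1 ∧ ∀ y ∈ Ω, ⟪n, y - b⟫ ≤ 0 := by
  obtain ⟨f, hf⟩ := geometric_hahn_banach_open_point hΩ.2.1.interior isOpen_interior hb
  have hf2 : ∀ y ∈ Ω, f y ≤ f b := by
    intro y hy
    have h1 : y ∈ closure (interior Ω) := by
      rw [hΩ.2.1.closure_interior_eq_closure_of_nonempty_interior hΩ.2.2]
      exact subset_closure hy
    have h2 : closure (interior Ω) ⊆ {z | f z ≤ f b} :=
      closure_minimal (fun z hz => (hf z hz).le) (isClosed_le f.continuous continuous_const)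
    exact h2 h1
  set g : E2 := (InnerProductSpace.toDual ℝ E2).symm f with hg
  have hgf : ∀ y, ⟪g, y⟫ = f y := fun y => by simp [hg]
  have hg0 : g ≠ 0 := by
    intro h0
    obtain ⟨z, hz⟩ := hΩ.2.2
    have := hf z hz
    rw [← hgf, ← hgf, h0] at this
    simp at this
  refine ⟨‖g‖⁻¹ • g, ?_, fun y hy => ?_⟩
  · rw [norm_smul, norm_inv, norm_norm, inv_mul_cancel₀ (norm_ne_zero_iff.2 hg0)]
  · rw [inner_smul_left, inner_sub_right, hgf, hgf]
    exact mul_nonpos_of_nonneg_of_nonpos (by simp) (by linarith [hf2 y hy])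

lemma vol_int_lt {Ω : Set E2} (hΩ : IsConvexBody2 Ω) : volume (interior Ω) < ⊤ :=
  (measure_mono interior_subset).trans_lt hΩ.1.measure_lt_top

lemma int_F {Ω : Set E2} (hΩ : IsConvexBody2 Ω) (w : E2 → ℝ) :
    IntegrableOn (fun p => (1 + ‖gradient w p‖ ^ 2)⁻¹) (interior Ω) := by
  refine Measure.integrableOn_of_bounded (M := 1) (vol_int_lt hΩ).ne ?_ ?_
  · have := (meas_gradient w).norm
    exact (((this.pow_const 2).const_add 1).inv).aestronglyMeasurable
  · refine ae_of_all _ fun p => ?_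
    rw [Real.norm_of_nonneg (by positivity)]
    exact inv_le_one_of_one_le₀ (by nlinarith [sq_nonneg ‖gradient w p‖])

lemma NewtonF_eq {Ω : Set E2} (hΩ : IsConvexBody2 Ω) (w : E2 → ℝ) :
    NewtonF Ω w = ∫ p in interior Ω, (1 + ‖gradient w p‖ ^ 2)⁻¹ := by
  unfold NewtonF
  exact setIntegral_congr_set (interior_ae_eq_of_null_frontier (hΩ.2.1.addHaar_frontier _)).symm

lemma lint_lt_top {Ω : Set E2} {M : ℝ} {u : E2 → ℝ} (hΩ : IsConvexBody2 Ω)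
    (hu : NewtonAdmissible Ω M u) :
    ∫⁻ x in interior Ω, ENNReal.ofReal ‖gradient u x‖ < ⊤ := by
  obtain ⟨z, hz⟩ := hΩ.2.2
  have hM : 0 ≤ M := (hu.2 z (interior_subset hz)).1.trans (hu.2 z (interior_subset hz)).2
  obtain ⟨R, hR⟩ := hΩ.1.isBounded.exists_norm_le
  have := crofton (v := fun _ => 0) (K := 0) (d := M) (m := 2 * R) hΩ hu.1
    (concaveOn_const 0 hΩ.2.1) (by simp) ?_ hM ?_ ?_
  · refine this.trans_lt ?_
    have : ∀ x : E2, gradient (fun _ : E2 => (0:ℝ)) x = 0 := fun x => by simp [gradient]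
    simp [this]
  · intro x hx b hb
    have := (hu.2 x (interior_subset hx)).1
    positivity
  · intro e' he
    refine ⟨Icc (-R) R, ?_, ?_⟩
    · rw [Real.volume_Icc]; apply ENNReal.ofReal_le_ofReal; linarith
    · intro x hx hnot
      exfalso; apply hnot
      rw [mem_Icc, ← abs_le]
      refine (abs_real_inner_le_norm _ _).trans ?_
      rw [he, mul_one]
      exact hR _ (interior_subset hx)
  · intro e' he x hx
    exact ⟨x, hx, rfl, by simpa using (hu.2 x (interior_subset hx)).2⟩

lemma int_N {Ω : Set E2} {M : ℝ} {u : E2 → ℝ} (hΩ : IsConvexBody2 Ω)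
    (hu : NewtonAdmissible Ω M u) :
    IntegrableOn (fun p => ‖gradient u p‖) (interior Ω) := by
  refine ⟨(meas_gradient u).norm.aestronglyMeasurable, ?_⟩
  rw [hasFiniteIntegral_iff_norm]
  simpa using lint_lt_top hΩ hu

lemma crofton_real {Ω : Set E2} {u v : E2 → ℝ} {M d : ℝ} (hΩ : IsConvexBody2 Ω)
    (hu : NewtonAdmissible Ω M u) (hv : NewtonAdmissible Ω M v)
    (hi : ∀ x ∈ interior Ω, ∀ b ∈ frontier Ω, v x ≤ u x + 2 * ‖x - b‖) {m : ℝ} (hd : 0 ≤ d)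
    (hm : 0 ≤ m)
    (hB : ∀ e' : E2, ‖e'‖ = 1 → ∃ B : Set ℝ, volume B ≤ ENNReal.ofReal m ∧
      ∀ x ∈ interior Ω, ⟪x, e'⟫ ∉ B → ∃ y ∈ interior Ω, ⟪y, e'⟫ = ⟪x, e'⟫ ∧ u x ≤ v y)
    (hB2 : ∀ e' : E2, ‖e'‖ = 1 →
      ∀ x ∈ interior Ω, ∃ y ∈ interior Ω, ⟪y, e'⟫ = ⟪x, e'⟫ ∧ u x ≤ v y + d) :
    ∫ x in interior Ω, ‖gradient u x‖ ≤
      (∫ x in interior Ω, ‖gradient v x‖) + 4 * Real.pi / cC * d * m := by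
  have h := crofton hΩ hu.1 hv.1 (fun x hx => (hv.2 x hx).2) hi hd hB hB2
  have hC := cC_pos
  rw [← ofReal_integral_eq_lintegral_ofReal (int_N hΩ hu) (ae_of_all _ fun x => norm_nonneg _),
    ← ofReal_integral_eq_lintegral_ofReal (int_N hΩ hv) (ae_of_all _ fun x => norm_nonneg _),
    ← ENNReal.ofReal_add (integral_nonneg fun x => norm_nonneg _) (by positivity)] at h
  rwa [ENNReal.ofReal_le_ofReal_iff] at h
  have : 0 ≤ ∫ x in interior Ω, ‖gradient v x‖ := integral_nonneg fun x => norm_nonneg _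
  positivity

/-- Affine majorants of `u` with slope at least one. -/
def AffMaj (Ω : Set E2) (u : E2 → ℝ) : Set (E2 × ℝ) :=
  {p | 1 ≤ ‖p.1‖ ∧ ∀ y ∈ Ω, u y ≤ p.2 + ⟪p.1, y⟫}

/-- The values at `x` of the affine majorants. -/
def AffVal (Ω : Set E2) (u : E2 → ℝ) (M : ℝ) (x : E2) : Set ℝ :=
  insert M ((fun p : E2 × ℝ => p.2 + ⟪p.1, x⟫) '' AffMaj Ω u)

/-- The steep envelope. -/
def steep (Ω : Set E2) (u : E2 → ℝ) (M : ℝ) (x : E2) : ℝ := sInf (AffVal Ω u M x)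

section steepLemmas
variable {Ω : Set E2} {M : ℝ} {u : E2 → ℝ}

lemma AffVal_lb (hu : NewtonAdmissible Ω M u) {x : E2} (hx : x ∈ Ω) :
    u x ∈ lowerBounds (AffVal Ω u M x) := by
  rintro c (rfl | ⟨p, hp, rfl⟩)
  · exact (hu.2 x hx).2
  · exact hp.2 x hx

lemma le_steep (hu : NewtonAdmissible Ω M u) {x : E2} (hx : x ∈ Ω) : u x ≤ steep Ω u M x :=
  le_csInf ⟨M, mem_insert _ _⟩ (AffVal_lb hu hx)

lemma steep_le_M (hu : NewtonAdmissible Ω M u) {x : E2} (hx : x ∈ Ω) : steep Ω u M x ≤ M :=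
  csInf_le ⟨_, AffVal_lb hu hx⟩ (mem_insert _ _)

lemma steep_le (hu : NewtonAdmissible Ω M u) {x : E2} (hx : x ∈ Ω) {p : E2 × ℝ}
    (hp : p ∈ AffMaj Ω u) : steep Ω u M x ≤ p.2 + ⟪p.1, x⟫ :=
  csInf_le ⟨_, AffVal_lb hu hx⟩ (mem_insert_of_mem _ ⟨p, hp, rfl⟩)

lemma exists_lt_steep {x : E2} {c : ℝ} (h : steep Ω u M x < c) (hc : c ≤ M) :
    ∃ p ∈ AffMaj Ω u, p.2 + ⟪p.1, x⟫ < c := by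
  obtain ⟨y, (rfl | ⟨p, hp, rfl⟩), hy⟩ := exists_lt_of_csInf_lt ⟨M, mem_insert _ _⟩ h
  · exact absurd hy hc.not_gt
  · exact ⟨p, hp, hy⟩

lemma steep_adm (hΩ : IsConvexBody2 Ω) (hu : NewtonAdmissible Ω M u) :
    NewtonAdmissible Ω M (steep Ω u M) := by
  refine ⟨⟨hΩ.2.1, ?_⟩, fun x hx => ⟨(hu.2 x hx).1.trans (le_steep hu hx), steep_le_M hu hx⟩⟩
  intro x hx y hy a b ha hb hab
  refine le_csInf ⟨M, mem_insert _ _⟩ ?_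
  rintro c (rfl | ⟨p, hp, rfl⟩)
  · have h1 := steep_le_M hu hx
    have h2 := steep_le_M hu hy
    simp only [smul_eq_mul]
    have : c = a * c + b * c := by rw [← add_mul, hab, one_mul]
    linarith [mul_le_mul_of_nonneg_left h1 ha, mul_le_mul_of_nonneg_left h2 hb]
  · have h1 := steep_le hu hx hp
    have h2 := steep_le hu hy hp
    simp only [smul_eq_mul, inner_add_right, inner_smul_right]
    have : p.2 = a * p.2 + b * p.2 := by rw [← add_mul, hab, one_mul]
    nlinarith [mul_le_mul_of_nonneg_left h1 ha, mul_le_mul_of_nonneg_left h2 hb]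

lemma steep_bd (hΩ : IsConvexBody2 Ω) (hu : NewtonAdmissible Ω M u) {x b : E2}
    (hx : x ∈ interior Ω) (hb : b ∈ frontier Ω) : steep Ω u M x ≤ u x + 2 * ‖x - b‖ := by
  obtain ⟨ξ, hξ⟩ := exists_supergradient hu.1 hx
  by_cases h1 : 1 ≤ ‖ξ‖
  · have : (ξ, u x - ⟪ξ, x⟫) ∈ AffMaj Ω u := by
      refine ⟨h1, fun y hy => ?_⟩
      have := hξ y hy
      rw [inner_sub_right] at this
      simp only; linarith
    have := steep_le hu (interior_subset hx) this
    simp only at this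
    have := norm_nonneg (x - b)
    linarith
  · obtain ⟨n, hn, hny⟩ := exists_normal hΩ hb.2
    have : (ξ - (2:ℝ) • n, u x - ⟪ξ, x⟫ + 2 * ⟪n, b⟫) ∈ AffMaj Ω u := by
      refine ⟨?_, fun y hy => ?_⟩
      · have := norm_sub_norm_le ((2:ℝ) • n) ξ
        rw [norm_smul, hn, norm_sub_rev] at this
        simp only [Real.norm_ofNat] at this
        push Not at h1
        simp only; linarith
      · have := hξ y hy
        have h2 := hny y hy
        rw [inner_sub_right] at this h2
        simp only [inner_sub_left, inner_smul_left]
        simp only [conj_trivial]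
        linarith
    have := steep_le hu (interior_subset hx) this
    simp only [inner_sub_left, inner_smul_left, conj_trivial] at this
    have h3 : ⟪n, b - x⟫ ≤ ‖x - b‖ := by
      refine (real_inner_le_norm _ _).trans ?_
      rw [hn, one_mul, norm_sub_rev]
    rw [inner_sub_right] at h3
    linarith

lemma steep_grad (hu : NewtonAdmissible Ω M u) {x : E2}
    (hx : x ∈ interior Ω) (hd : DifferentiableAt ℝ (steep Ω u M) x) (hlt : u x < steep Ω u M x)
    (hc : ConcaveOn ℝ Ω (steep Ω u M)) :
    ‖gradient (steep Ω u M) x‖ = 0 ∨ ‖gradient (steep Ω u M) x‖ = 1 := by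
  have hxΩ := interior_subset hx
  have hnh : Ω ∈ 𝓝 x := mem_interior_iff_mem_nhds.1 hx
  rcases (steep_le_M hu hxΩ).eq_or_lt with hM | hM
  · left
    have : IsLocalMax (steep Ω u M) x := by
      filter_upwards [hnh] with y hy
      rw [hM]; exact steep_le_M hu hy
    have := this.fderiv_eq_zero
    simp [gradient, this]
  · right
    refine le_antisymm ?_ ?_
    · by_contra hgt
      push Not at hgt
      set g := gradient (steep Ω u M) x with hg
      obtain ⟨ξ, hξ⟩ := exists_supergradient hu.1 hx
      have hcon : ContinuousAt (fun l : ℝ => ‖(1 - l) • g + l • ξ‖) 0 := by fun_prop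
      have hev : ∀ᶠ l in 𝓝 (0:ℝ), 1 < ‖(1 - l) • g + l • ξ‖ :=
        hcon.eventually (lt_mem_nhds (by simpa using hgt))
      have hev2 : ∀ᶠ l in 𝓝[>] (0:ℝ), 1 < ‖(1 - l) • g + l • ξ‖ ∧ l ∈ Ioo (0:ℝ) 1 :=
        (hev.filter_mono nhdsWithin_le_nhds).and (Ioo_mem_nhdsGT one_pos)
      obtain ⟨l, hl, hl0, hl1⟩ := hev2.exists
      have hmem : ((1 - l) • g + l • ξ, (1 - l) * (steep Ω u M x - ⟪g, x⟫) + l * (u x - ⟪ξ, x⟫))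
          ∈ AffMaj Ω u := by
        refine ⟨hl.le, fun y hy => ?_⟩
        have h1 := (le_steep hu hy).trans (support_of_diff hc hxΩ hy hd)
        have h2 := hξ y hy
        rw [inner_sub_right] at h1 h2
        simp only [inner_add_left, inner_smul_left, conj_trivial]
        nlinarith [mul_le_mul_of_nonneg_left h1 (sub_nonneg.2 hl1.le),
          mul_le_mul_of_nonneg_left h2 hl0.le]
      have := steep_le hu hxΩ hmem
      simp only [inner_add_left, inner_smul_left, conj_trivial] at this
      nlinarith
    · refine one_le_norm_gradient hd hnh fun η hη => ?_
      obtain ⟨p, hp, hpl⟩ := exists_lt_steep (Ω := Ω) (u := u) (M := M) (x := x)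
        (c := min M (steep Ω u M x + η)) (lt_min hM (by linarith)) (min_le_left _ _)
      refine ⟨p.1, hp.1, fun y hy => ?_⟩
      have h1 := steep_le hu hy hp
      have h2 := hpl.trans_le (min_le_right _ _)
      rw [inner_sub_right]
      linarith

lemma contact_grad (hu : NewtonAdmissible Ω M u) {x : E2}
    (hx : x ∈ interior Ω) (hd : DifferentiableAt ℝ u x) (he : u x = steep Ω u M x) :
    ‖gradient u x‖ = 0 ∨ 1 ≤ ‖gradient u x‖ := by
  have hxΩ := interior_subset hx
  have hnh : Ω ∈ 𝓝 x := mem_interior_iff_mem_nhds.1 hx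
  rcases (hu.2 x hxΩ).2.eq_or_lt with hM | hM
  · left
    have : IsLocalMax u x := by
      filter_upwards [hnh] with y hy
      rw [hM]; exact (hu.2 y hy).2
    have := this.fderiv_eq_zero
    simp [gradient, this]
  · right
    refine one_le_norm_gradient hd hnh fun η hη => ?_
    obtain ⟨p, hp, hpl⟩ := exists_lt_steep (Ω := Ω) (u := u) (M := M) (x := x)
      (c := min M (u x + η)) (by rw [← he]; exact (lt_min hM (by linarith))) (min_le_left _ _)
    refine ⟨p.1, hp.1, fun y hy => ?_⟩
    have h1 := hp.2 y hy
    have h2 := hpl.trans_le (min_le_right _ _)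
    rw [inner_sub_right]
    linarith

lemma partA (hΩ : IsConvexBody2 Ω) (hu : NewtonAdmissible Ω M u)
    (hmin : ∀ v : E2 → ℝ, NewtonAdmissible Ω M v → NewtonF Ω u ≤ NewtonF Ω v) :
    ∀ᵐ x ∂(volume : Measure E2), x ∈ interior Ω → ‖gradient u x‖ = 0 ∨ 1 ≤ ‖gradient u x‖ := by
  set v := steep Ω u M with hv
  have hva : NewtonAdmissible Ω M v := steep_adm hΩ hu
  have hF := hmin v hva
  rw [NewtonF_eq hΩ, NewtonF_eq hΩ] at hF
  have hC := crofton_real (d := 0) (m := 0) hΩ hu hva (fun x hx b hb => steep_bd hΩ hu hx hb)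
    le_rfl le_rfl (fun e' _ => ⟨∅, by simp, fun x hx _ => ⟨x, hx, rfl, le_steep hu (interior_subset hx)⟩⟩)
    (fun e' _ x hx => ⟨x, hx, rfl, by simpa using le_steep hu (interior_subset hx)⟩)
  simp only [mul_zero, add_zero] at hC
  set G : E2 → ℝ := fun x => ((1 + ‖gradient u x‖ ^ 2)⁻¹ - (1 + ‖gradient v x‖ ^ 2)⁻¹)
    - (‖gradient v x‖ / 2 - ‖gradient u x‖ / 2) with hG
  have hGi : IntegrableOn G (interior Ω) :=
    ((int_F hΩ u).sub (int_F hΩ v)).sub (((int_N hΩ hva).div_const 2).sub ((int_N hΩ hu).div_const 2))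
  have hGint : ∫ x in interior Ω, G x ≤ 0 := by
    have e1 := integral_sub ((int_F hΩ u).sub (int_F hΩ v))
      (((int_N hΩ hva).div_const 2).sub ((int_N hΩ hu).div_const 2))
    have e2 := integral_sub (int_F hΩ u) (int_F hΩ v)
    have e3 := integral_sub ((int_N hΩ hva).div_const 2) ((int_N hΩ hu).div_const 2)
    simp only [Pi.sub_apply] at e1 e2 e3
    rw [e2, e3, integral_div, integral_div] at e1
    simp only [hG]
    rw [e1]
    linarith
  have hf : ∀ s : ℝ, s = 0 ∨ s = 1 → (1 + s ^ 2)⁻¹ = 1 - s / 2 := by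
    rintro s (rfl | rfl) <;> norm_num
  have hid : ∀ s : ℝ, (1 + s ^ 2)⁻¹ = 1 - s / 2 + s * (s - 1) ^ 2 / (2 * (1 + s ^ 2)) := by
    intro s
    have : 1 + s ^ 2 ≠ 0 := by positivity
    field_simp
    ring
  have hval : ∀ᵐ x ∂(volume : Measure E2), x ∈ interior Ω → (u x = v x ∧ G x = 0) ∨
      G x = ‖gradient u x‖ * (‖gradient u x‖ - 1) ^ 2 / (2 * (1 + ‖gradient u x‖ ^ 2)) := by
    filter_upwards [ae_diff hu.1, ae_diff hva.1] with x h1 h2 hx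
    rcases (le_steep hu (interior_subset hx)).eq_or_lt with he | hl
    · left
      refine ⟨he, ?_⟩
      have := gradient_eq_of_le (h1 hx) (h2 hx) (by
        filter_upwards [mem_interior_iff_mem_nhds.1 hx] with y hy using le_steep hu hy) he
      simp [hG, this]
    · right
      simp only [hG]
      rw [hf _ (steep_grad hu hx (h2 hx) hl hva.1), hid ‖gradient u x‖]
      ring
  have hG0 : ∀ᵐ x ∂(volume.restrict (interior Ω)), 0 ≤ G x := by
    rw [ae_restrict_iff' isOpen_interior.measurableSet]
    filter_upwards [hval] with x h hx
    rcases h hx with h | h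
    · rw [h.2]
    · rw [h]; positivity
  have hGz : G =ᵐ[volume.restrict (interior Ω)] 0 := by
    rw [← integral_eq_zero_iff_of_nonneg_ae hG0 hGi]
    exact le_antisymm hGint (integral_nonneg_of_ae hG0)
  rw [EventuallyEq, ae_restrict_iff' isOpen_interior.measurableSet] at hGz
  filter_upwards [hval, hGz, ae_diff hu.1] with x h1 h2 h3 hx
  rcases h1 hx with h | h
  · exact contact_grad hu hx (h3 hx) h.1
  · rw [h2 hx] at h
    have : (2 * (1 + ‖gradient u x‖ ^ 2)) ≠ 0 := by positivity
    simp only [Pi.zero_apply] at h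
    rw [eq_comm, div_eq_zero_iff] at h
    rcases h with h | h
    · rcases mul_eq_zero.1 h with h | h
      · left; exact h
      · right
        have := pow_eq_zero_iff (two_ne_zero) |>.1 h
        linarith
    · exact absurd h this

lemma partA' (hΩ : IsConvexBody2 Ω) (hu : NewtonAdmissible Ω M u)
    (hmin : ∀ v : E2 → ℝ, NewtonAdmissible Ω M v → NewtonF Ω u ≤ NewtonF Ω v)
    (hne : {p : E2 | p ∈ Ω ∧ u p = M}.Nonempty) {p : E2} (hp : p ∈ Ω)
    (hd : DifferentiableAt ℝ u p) (hpM : u p < M) : 1 ≤ ‖gradient u p‖ := by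
  refine one_le_of_ae hu.1 hΩ.2.2 ?_ hp hd hpM
  filter_upwards [partA hΩ hu hmin, ae_diff hu.1] with x h1 h2 hx hxM
  rcases h1 hx with h | h
  · obtain ⟨q, hq, hqM⟩ := hne
    have := support_of_diff hu.1 (interior_subset hx) hq (h2 hx)
    rw [norm_eq_zero.1 h, inner_zero_left] at this
    linarith
  · exact h

end steepLemmas

/-- The upper level set. -/
def Lev (Ω : Set E2) (u : E2 → ℝ) (M : ℝ) : Set E2 := {p : E2 | p ∈ Ω ∧ u p = M}

section levelLemmas
variable {Ω : Set E2} {M : ℝ} {u : E2 → ℝ}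

lemma Lev_convex (hu : NewtonAdmissible Ω M u) : Convex ℝ (Lev Ω u M) := by
  intro x hx y hy a b ha hb hab
  have hm := hu.1.1 hx.1 hy.1 ha hb hab
  refine ⟨hm, le_antisymm (hu.2 _ hm).2 ?_⟩
  have := hu.1.2 hx.1 hy.1 ha hb hab
  rw [hx.2, hy.2, ← add_smul, hab, one_smul] at this
  exact this

lemma near_level (hΩ : IsConvexBody2 Ω) (hu : NewtonAdmissible Ω M u) {z₀ : E2}
    (hz : z₀ ∈ interior (Lev Ω u M)) {ω : ℝ} (hω : 0 < ω) :
    ∃ τ > 0, ∀ x ∈ interior Ω, M - τ < u x → ∃ y ∈ Lev Ω u M, ‖x - y‖ < ω := by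
  by_contra hcon
  push Not at hcon
  have hk : ∀ k : ℕ, ∃ x ∈ interior Ω, M - 1 / ((k:ℝ) + 1) < u x ∧ ∀ y ∈ Lev Ω u M, ω ≤ ‖x - y‖ :=
    fun k => hcon _ (by positivity)
  choose x hxΩ hxu hxd using hk
  obtain ⟨x', hx', φ, hφ, hlim⟩ := hΩ.1.tendsto_subseq (fun k => interior_subset (hxΩ k))
  have hzΩ : z₀ ∈ interior Ω := interior_mono (fun p hp => hp.1) hz
  have hev : ∀ᶠ t in 𝓝[>] (0:ℝ), ‖x' - (t • z₀ + (1 - t) • x')‖ < ω ∧ t ∈ Ioo (0:ℝ) 1 := by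
    refine Filter.Eventually.and (Filter.Eventually.filter_mono nhdsWithin_le_nhds ?_)
      (Ioo_mem_nhdsGT one_pos)
    have hcon : ContinuousAt (fun t : ℝ => ‖x' - (t • z₀ + (1 - t) • x')‖) 0 := by fun_prop
    exact hcon.eventually (gt_mem_nhds (by simpa using hω))
  obtain ⟨t, ht, ht0, ht1⟩ := hev.exists
  set y := t • z₀ + (1 - t) • x' with hy
  have hyΩ : y ∈ interior Ω := hΩ.2.1.combo_interior_closure_mem_interior hzΩ (subset_closure hx')
    ht0 (sub_nonneg.2 ht1.le) (by ring)
  have hylim : Tendsto (fun k => t • z₀ + (1 - t) • x (φ k)) atTop (𝓝 y) :=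
    (hlim.const_smul (1 - t)).const_add _
  have hucont : ContinuousAt u y :=
    (hu.1.continuousOn_interior).continuousAt (isOpen_interior.mem_nhds hyΩ)
  have h1 : Tendsto (fun k => u (t • z₀ + (1 - t) • x (φ k))) atTop (𝓝 (u y)) :=
    hucont.tendsto.comp hylim
  have h2 : Tendsto (fun k => M - (1 - t) * (1 / ((φ k : ℝ) + 1))) atTop (𝓝 (M - (1 - t) * 0)) := by
    refine (Tendsto.const_mul _ ?_).const_sub _
    exact tendsto_one_div_add_atTop_nhds_zero_nat.comp hφ.tendsto_atTop
  have h3 : M - (1 - t) * 0 ≤ u y := by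
    refine le_of_tendsto_of_tendsto' h2 h1 fun k => ?_
    have := hu.1.2 (interior_subset hzΩ) (interior_subset (hxΩ (φ k))) ht0.le (sub_nonneg.2 ht1.le)
      (by ring)
    refine le_trans ?_ this
    rw [(interior_subset hz).2]
    simp only [smul_eq_mul]
    have := hxu (φ k)
    nlinarith
  have hyL : y ∈ Lev Ω u M :=
    ⟨interior_subset hyΩ, le_antisymm (hu.2 _ (interior_subset hyΩ)).2 (by linarith)⟩
  have h4 : Tendsto (fun k => ‖x (φ k) - y‖) atTop (𝓝 ‖x' - y‖) := (hlim.sub_const y).norm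
  have := ge_of_tendsto' h4 (fun k => hxd (φ k) y hyL)
  linarith

/-- The volume of the layer is of order `ε`. -/
lemma vol_layer (hΩ : IsConvexBody2 Ω) {h : E2 → ℝ}
    (hconv : ConvexOn ℝ univ h) (hcont : Continuous h) {z₀ : E2} {ρ c ε l : ℝ}
    (hzΩ : z₀ ∈ interior Ω) (hz : h z₀ ≤ -ρ) (hε : 0 < ε) (hc : 0 ≤ c) (hl0 : 0 ≤ l) (hl1 : l < 1)
    (hlρ : ε + c ≤ l * ρ) :
    volume (interior Ω ∩ {x | -ε < h x ∧ h x < c}) ≤ ENNReal.ofReal (2 * l) * volume (interior Ω) := by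
  set E := interior Ω ∩ {x | h x < c} with hE
  have hEo : IsOpen E := isOpen_interior.inter (isOpen_lt hcont continuous_const)
  set A := AffineMap.homothety z₀ (1 - l) '' E with hA
  have hAx : ∀ x, AffineMap.homothety z₀ (1 - l) x = l • z₀ + (1 - l) • x := by
    intro x
    simp only [AffineMap.homothety_apply, vsub_eq_sub, vadd_eq_add]
    module
  have hAE : ∀ x ∈ A, x ∈ E ∧ h x ≤ -ε := by
    rintro _ ⟨x, hx, rfl⟩
    rw [hAx]
    have h1 : h (l • z₀ + (1 - l) • x) ≤ -ε := by
      have := hconv.2 (mem_univ z₀) (mem_univ x) hl0 (sub_nonneg.2 hl1.le) (by ring)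
      simp only [smul_eq_mul] at this
      have hx2 : h x < c := hx.2
      nlinarith [mul_le_mul_of_nonneg_left hz hl0, 
        mul_le_mul_of_nonneg_left hx2.le (sub_nonneg.2 hl1.le), mul_nonneg hl0 hc]
    refine ⟨⟨hΩ.2.1.interior hzΩ hx.1 hl0 (sub_nonneg.2 hl1.le) (by ring), ?_⟩, h1⟩
    show h _ < c
    linarith
  have hAm : MeasurableSet A := by
    have h1l : (1 - l) ≠ 0 := (sub_pos.2 hl1).ne'
    have : IsOpen A := AffineMap.homothety_isOpenMap z₀ (1 - l) h1l E hEo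
    exact this.measurableSet
  have hvA : volume A = ENNReal.ofReal ((1 - l) ^ 2) * volume E := by
    rw [hA, Measure.addHaar_image_homothety]
    simp
  have hvE : volume E ≤ volume (interior Ω) := measure_mono inter_subset_left
  have hEfin : volume E ≠ ⊤ := (hvE.trans_lt (vol_int_lt hΩ)).ne
  have hsub : interior Ω ∩ {x | -ε < h x ∧ h x < c} ⊆ E \ A := by
    rintro x ⟨hx1, hx2, hx3⟩
    exact ⟨⟨hx1, hx3⟩, fun hxA => absurd (hAE x hxA).2 hx2.not_ge⟩
  refine (measure_mono hsub).trans ?_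
  have hAs : A ⊆ E := fun x hx => (hAE x hx).1
  rw [measure_sdiff hAs hAm.nullMeasurableSet ((measure_mono hAs).trans_lt hEfin.lt_top).ne, hvA]
  rw [tsub_le_iff_right]
  calc volume E = ENNReal.ofReal 1 * volume E := by simp
    _ ≤ (ENNReal.ofReal (2 * l) + ENNReal.ofReal ((1 - l) ^ 2)) * volume E := by
        gcongr
        rw [← ENNReal.ofReal_add (by positivity) (by positivity)]
        apply ENNReal.ofReal_le_ofReal
        nlinarith
    _ ≤ ENNReal.ofReal (2 * l) * volume (interior Ω) + ENNReal.ofReal ((1 - l) ^ 2) * volume E := by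
        rw [add_mul]
        gcongr

/-- The lines through the middle of the level set. -/
lemma middle (hu : NewtonAdmissible Ω M u) {h : E2 → ℝ} (hconv : ConvexOn ℝ univ h)
    {z₀ : E2} {ρ ω R l : ℝ} (hω : 0 < ω) (hzL : z₀ ∈ interior (Lev Ω u M)) (hz : h z₀ ≤ -ρ)
    (hR : ∀ x ∈ Ω, ‖x‖ ≤ R)
    (hL : ∀ x ∈ Lev Ω u M, h x ≤ 0) (hl0 : 0 < l) (hl1 : l < 1) {e' : E2} (he : ‖e'‖ = 1) :
    ∃ B : Set ℝ, volume B ≤ ENNReal.ofReal (2 * (ω + 2 * R * l)) ∧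
      ∀ x, (∃ y ∈ Lev Ω u M, ‖x - y‖ < ω) → ⟪x, e'⟫ ∉ B →
        ∃ y ∈ interior (Lev Ω u M), ⟪y, e'⟫ = ⟪x, e'⟫ ∧ h y ≤ -(l * ρ) := by
  set L := Lev Ω u M with hLdef
  set T := (fun x : E2 => ⟪x, e'⟫) '' L with hT
  have hin : ∀ x : E2, |⟪x, e'⟫| ≤ ‖x‖ := fun x => by
    have := abs_real_inner_le_norm x e'
    rwa [he, mul_one] at this
  have hTR : ∀ t ∈ T, |t| ≤ R := by
    rintro _ ⟨x, hx, rfl⟩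
    exact (hin x).trans (hR x hx.1)
  have hTb : BddBelow T := ⟨-R, fun t ht => (abs_le.1 (hTR t ht)).1⟩
  have hTa : BddAbove T := ⟨R, fun t ht => (abs_le.1 (hTR t ht)).2⟩
  have hσ : ⟪z₀, e'⟫ ∈ T := ⟨z₀, interior_subset hzL, rfl⟩
  have hTc : T.OrdConnected := by
    have : Convex ℝ T := by
      have := (Lev_convex hu).is_linear_image (f := fun x : E2 => ⟪x, e'⟫)
        ⟨fun x y => inner_add_left _ _ _, fun c x => by simp [inner_smul_left]⟩
      exact this
    exact this.ordConnected
  set a := sInf T with ha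
  set b := sSup T with hb
  set σ := ⟪z₀, e'⟫ with hσdef
  have haR : -R ≤ a := le_csInf ⟨σ, hσ⟩ fun t ht => (abs_le.1 (hTR t ht)).1
  have hbR : b ≤ R := csSup_le ⟨σ, hσ⟩ fun t ht => (abs_le.1 (hTR t ht)).2
  have hσR := abs_le.1 (hTR σ hσ)
  refine ⟨Icc (a - ω) (a + 2 * R * l) ∪ Icc (b - 2 * R * l) (b + ω), ?_, ?_⟩
  · refine (measure_union_le _ _).trans ?_
    have hR0 : 0 ≤ R := by linarith
    rw [Real.volume_Icc, Real.volume_Icc, ← ENNReal.ofReal_add]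
    · apply ENNReal.ofReal_le_ofReal; linarith
    · nlinarith [mul_nonneg hR0 hl0.le]
    · nlinarith [mul_nonneg hR0 hl0.le]
  · rintro x ⟨y, hyL, hxy⟩ hnot
    rw [mem_union, not_or] at hnot
    have hyT : ⟪y, e'⟫ ∈ T := ⟨y, hyL, rfl⟩
    have h1 := csInf_le hTb hyT
    have h2 := le_csSup hTa hyT
    have h3 : |⟪x, e'⟫ - ⟪y, e'⟫| < ω := by
      rw [← inner_sub_left]; exact (hin _).trans_lt hxy
    rw [abs_lt] at h3
    have h4 : a + 2 * R * l < ⟪x, e'⟫ := by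
      by_contra hh; exact hnot.1 ⟨by linarith, not_lt.1 hh⟩
    have h5 : ⟪x, e'⟫ < b - 2 * R * l := by
      by_contra hh; exact hnot.2 ⟨not_lt.1 hh, by linarith⟩
    have hl : 0 < 1 - l := sub_pos.2 hl1
    set s := ⟪x, e'⟫ with hs
    have h6 : a < (s - l * σ) / (1 - l) := by
      rw [lt_div_iff₀ hl]; nlinarith
    have h7 : (s - l * σ) / (1 - l) < b := by
      rw [div_lt_iff₀ hl]; nlinarith
    obtain ⟨t1, ht1, ht1'⟩ := exists_lt_of_csInf_lt ⟨σ, hσ⟩ h6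
    obtain ⟨t2, ht2, ht2'⟩ := exists_lt_of_lt_csSup ⟨σ, hσ⟩ h7
    obtain ⟨w, hw, hws⟩ := hTc.out ht1 ht2 ⟨ht1'.le, ht2'.le⟩
    refine ⟨l • z₀ + (1 - l) • w, ?_, ?_, ?_⟩
    · exact (Lev_convex hu).combo_interior_self_mem_interior hzL hw hl0 hl.le (by ring)
    · simp only [inner_add_left, inner_smul_left, conj_trivial] at hws ⊢
      rw [hws, ← hσdef]
      field_simp
      ring
    · have := hconv.2 (mem_univ z₀) (mem_univ w) hl0.le hl.le (by ring)
      simp only [smul_eq_mul] at this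
      nlinarith [hL w hw, mul_le_mul_of_nonneg_left hz hl0.le]

end levelLemmas

lemma f_ineq {s κ : ℝ} (hs : 0 ≤ s) (hκ : 0 ≤ κ) :
    1 - κ - (1 / 2 - κ + κ ^ 2) * s ≤ (1 + s ^ 2)⁻¹ := by
  have h1 : 0 < 1 + s ^ 2 := by positivity
  have key : (1 + s ^ 2)⁻¹ - (1 - κ - (1 / 2 - κ + κ ^ 2) * s) =
      κ ^ 2 * s + κ * (1 - s) + s * (1 - s) ^ 2 / (2 * (1 + s ^ 2)) := by
    field_simp
    ring
  rw [← sub_nonneg, key]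
  rcases le_or_gt s 1 with h | h
  · have : 0 ≤ 1 - s := by linarith
    positivity
  · have h2 : (1 - s) ^ 2 / (4 * s) ≤ s * (1 - s) ^ 2 / (2 * (1 + s ^ 2)) := by
      rw [div_le_div_iff₀ (by positivity) (by positivity)]
      nlinarith [mul_nonneg (sq_nonneg (1 - s)) (by nlinarith : 0 ≤ s ^ 2 - 1)]
    have h3 : κ ^ 2 * s + κ * (1 - s) + (1 - s) ^ 2 / (4 * s) = (2 * κ * s + (1 - s)) ^ 2 / (4 * s) := by
      field_simp
      ring
    have : 0 ≤ (2 * κ * s + (1 - s)) ^ 2 / (4 * s) := by positivity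
    linarith

lemma norm_gradient_eq (w : E2 → ℝ) (x : E2) : ‖gradient w x‖ = ‖fderiv ℝ w x‖ := by
  simp [gradient]

section coreLemmas
variable {Ω : Set E2} {M : ℝ} {u : E2 → ℝ}

lemma core_eps (hΩ : IsConvexBody2 Ω) (hu : NewtonAdmissible Ω M u)
    (hmin : ∀ v : E2 → ℝ, NewtonAdmissible Ω M v → NewtonF Ω u ≤ NewtonF Ω v)
    {h : E2 → ℝ} (hconv : ConvexOn ℝ univ h) (hlip : ∀ x y, h x ≤ h y + ‖x - y‖)
    (hslope : ∀ x, ∀ η > 0, ∃ n : E2, ‖n‖ = 1 ∧ ∀ y, h x - η + ⟪n, y - x⟫ ≤ h y)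
    {z₀ : E2} {ρ δ ε ω R κ : ℝ} (hρ : 0 < ρ) (hδ : 0 < δ) (hε : 0 < ε) (hω : 0 < ω)
    (hzL : z₀ ∈ interior (Lev Ω u M)) (hz : h z₀ ≤ -ρ) (hR : ∀ x ∈ Ω, ‖x‖ ≤ R)
    (hle : ∀ x ∈ Ω, u x ≤ M - (1 + δ) * h x) (hεM : ε + ε / δ ≤ M) (hερ : ε / ρ < 1)
    (hnear : ∀ x ∈ interior Ω, M - (ε + ε / δ) < u x → ∃ y ∈ Lev Ω u M, ‖x - y‖ < ω)
    (hκ0 : 0 ≤ κ) (hκ1 : κ ≤ 1 / 2) :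
    κ * volume.real (interior (Lev Ω u M) ∩ {x | -ε < h x}) ≤
      κ ^ 2 * volume.real (interior Ω ∩ {x | -ε < h x ∧ h x < ε / δ}) +
        4 * Real.pi / cC * ε * (2 * (ω + 2 * R * (ε / ρ))) := by
  have hcont : Continuous h := by
    have : LipschitzWith 1 h := LipschitzWith.of_le_add fun x y => by
      rw [dist_eq_norm]; exact hlip x y
    exact this.continuous
  have hL0 : ∀ x ∈ Lev Ω u M, h x ≤ 0 := by
    intro x hx
    have := hle x hx.1
    rw [hx.2] at this
    nlinarith
  have hLΩ : interior (Lev Ω u M) ⊆ interior Ω := interior_mono fun p hp => hp.1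
  have hwc : ConcaveOn ℝ Ω (fun x => M - ε - h x) := by
    have h1 := (hconv.subset (subset_univ Ω) hΩ.2.1).neg
    have := h1.add_const (M - ε)
    refine this.congr fun x hx => ?_
    simp only [Pi.add_apply, Pi.neg_apply]; ring
  set v : E2 → ℝ := fun x => min (u x) (M - ε - h x) with hv
  have hDprop : ∀ x ∈ Ω, M - ε - h x < u x → -ε < h x ∧ h x < ε / δ := by
    intro x hx hlt
    have h1 := hle x hx
    have h2 := (hu.2 x hx).2
    refine ⟨by linarith, ?_⟩
    rw [lt_div_iff₀ hδ]; nlinarith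
  have hva : NewtonAdmissible Ω M v := by
    refine ⟨hu.1.inf hwc, fun x hx => ⟨le_min (hu.2 x hx).1 ?_, (min_le_left _ _).trans (hu.2 x hx).2⟩⟩
    rcases lt_or_ge (M - ε - h x) (u x) with hlt | hge
    · have := (hDprop x hx hlt).2; linarith
    · exact (hu.2 x hx).1.trans hge
  have huv : ∀ x ∈ Ω, u x ≤ v x + ε := by
    intro x hx
    rcases min_choice (u x) (M - ε - h x) with he | he
    · simp only [hv, he]; linarith
    · simp only [hv, he]
      have h1 := hle x hx
      have h2 := (hu.2 x hx).2
      rcases le_total 0 (h x) with h3 | h3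
      · nlinarith
      · linarith
  have hR0 : 0 ≤ R := (norm_nonneg z₀).trans (hR z₀ (interior_subset (hLΩ hzL)))
  have hCr := crofton_real (d := ε) (m := 2 * (ω + 2 * R * (ε / ρ))) hΩ hu hva ?_ hε.le
    (by positivity) ?_ ?_
  rotate_left
  · intro x hx b hb
    have : v x ≤ u x := min_le_left _ _
    have := norm_nonneg (x - b)
    linarith
  · intro e' he
    obtain ⟨B, hB1, hB2⟩ := middle hu hconv hω hzL hz hR hL0 (div_pos hε hρ) hερ he
    refine ⟨B, hB1, fun x hx hxB => ?_⟩
    rcases lt_or_ge (M - ε - h x) (u x) with hlt | hge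
    · have h1 := hDprop x (interior_subset hx) hlt
      obtain ⟨y, hyL, hye, hyh⟩ := hB2 x (hnear x hx (by linarith)) hxB
      refine ⟨y, hLΩ hyL, hye, ?_⟩
      rw [div_mul_cancel₀ _ hρ.ne'] at hyh
      have : v y = M := by
        simp only [hv]
        rw [(interior_subset hyL).2, min_eq_left (by linarith)]
      rw [this]
      exact (hu.2 x (interior_subset hx)).2
    · exact ⟨x, hx, rfl, (min_eq_left hge).ge⟩
  · intro e' he x hx
    exact ⟨x, hx, rfl, huv x (interior_subset hx)⟩
  set D : Set E2 := interior Ω ∩ {x | M - ε - h x < u x} with hD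
  have hDo : IsOpen D := by
    have h1 : ContinuousOn (fun x => u x - (M - ε - h x)) (interior Ω) :=
      (hu.1.continuousOn_interior).sub (by fun_prop)
    have := h1.isOpen_inter_preimage isOpen_interior (isOpen_Ioi (a := (0:ℝ)))
    convert this using 1
    ext x
    simp [hD]
  have hDvol : volume.real D ≤ volume.real (interior Ω ∩ {x | -ε < h x ∧ h x < ε / δ}) := by
    refine measureReal_mono ?_ ((measure_mono inter_subset_left).trans_lt (vol_int_lt hΩ)).ne
    exact fun x hx => ⟨hx.1, hDprop x (interior_subset hx.1) hx.2⟩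
  set N : Set E2 := interior (Lev Ω u M) ∩ {x | -ε < h x} with hN
  have hNo : IsOpen N := isOpen_interior.inter (isOpen_lt continuous_const hcont)
  have hND : N ⊆ D := by
    rintro x ⟨hx1, hx2⟩
    refine ⟨hLΩ hx1, ?_⟩
    show _ < u x
    rw [(interior_subset hx1).2]
    have : -ε < h x := hx2
    linarith
  have hDΩ : D ⊆ interior Ω := inter_subset_left
  -- pointwise inequality
  have hpt : ∀ᵐ x ∂(volume.restrict (interior Ω)),
      (D.indicator (fun _ => -κ ^ 2) x + N.indicator (fun _ => κ) x)
        - ((1 / 2 - κ + κ ^ 2) * ‖gradient u x‖ - (1 / 2 - κ + κ ^ 2) * ‖gradient v x‖) ≤ 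
      (1 + ‖gradient u x‖ ^ 2)⁻¹ - (1 + ‖gradient v x‖ ^ 2)⁻¹ := by
    rw [ae_restrict_iff' isOpen_interior.measurableSet]
    filter_upwards [ae_diff hu.1, ae_diff hva.1] with x h1 h2 hx
    by_cases hxD : x ∈ D
    · have hnorm : ‖gradient v x‖ = 1 := by
        have hvx : ∀ y ∈ D, v y = M - ε - h y := fun y hy => min_eq_right (le_of_lt hy.2)
        refine le_antisymm ?_ ?_
        · rw [norm_gradient_eq]
          refine norm_fderiv_le_of_lip' ℝ zero_le_one ?_
          filter_upwards [hDo.mem_nhds hxD] with y hy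
          rw [hvx y hy, hvx x hxD, one_mul, Real.norm_eq_abs, abs_le]
          have a1 := hlip x y
          have a2 := hlip y x
          rw [norm_sub_rev] at a1
          constructor <;> linarith
        · refine one_le_norm_gradient (h2 hx) (hDo.mem_nhds hxD) fun η hη => ?_
          obtain ⟨n, hn, hny⟩ := hslope x η hη
          refine ⟨-n, by rw [norm_neg, hn], fun y hy => ?_⟩
          rw [hvx y hy, hvx x hxD, inner_neg_left]
          linarith [hny y]
      rw [indicator_of_mem hxD, hnorm]
      by_cases hxN : x ∈ N
      · rw [indicator_of_mem hxN]
        have hg0 : gradient u x = 0 := by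
          have : IsLocalMax u x := by
            filter_upwards [isOpen_interior.mem_nhds hx] with y hy
            rw [(interior_subset hxN.1).2]; exact (hu.2 y (interior_subset hy)).2
          simp [gradient, this.fderiv_eq_zero]
        rw [hg0]
        norm_num
      · rw [indicator_of_notMem hxN]
        have := f_ineq (norm_nonneg (gradient u x)) hκ0
        norm_num
        linarith
    · have hxN : x ∉ N := fun hh => hxD (hND hh)
      rw [indicator_of_notMem hxD, indicator_of_notMem hxN]
      have hge : u x ≤ M - ε - h x := by
        by_contra hh
        exact hxD ⟨hx, not_le.1 hh⟩
      have hvux : v x = u x := min_eq_left hge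
      have : gradient v x = gradient u x := gradient_eq_of_le (h2 hx) (h1 hx)
        (Eventually.of_forall fun y => min_le_left _ _) hvux
      rw [this]; simp
  have hi1 : IntegrableOn (D.indicator (fun _ => -κ ^ 2)) (interior Ω) :=
    (integrableOn_const (vol_int_lt hΩ).ne).indicator hDo.measurableSet
  have hi2 : IntegrableOn (N.indicator (fun _ => κ)) (interior Ω) :=
    (integrableOn_const (vol_int_lt hΩ).ne).indicator hNo.measurableSet
  have hi3 := (int_N hΩ hu).const_mul (1 / 2 - κ + κ ^ 2)
  have hi4 := (int_N hΩ hva).const_mul (1 / 2 - κ + κ ^ 2)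
  have hmono := integral_mono_ae ((hi1.add hi2).sub (hi3.sub hi4))
    ((int_F hΩ u).sub (int_F hΩ v)) hpt
  have e1 := integral_sub (hi1.add hi2) (hi3.sub hi4)
  have e2 := integral_add hi1 hi2
  have e3 := integral_sub hi3 hi4
  have e4 := integral_sub (int_F hΩ u) (int_F hΩ v)
  simp only [Pi.sub_apply, Pi.add_apply] at e1 e2 e3 e4 hmono
  rw [e1, e2, e3, e4, integral_const_mul, integral_const_mul,
    integral_indicator hDo.measurableSet, integral_indicator hNo.measurableSet,
    Measure.restrict_restrict hDo.measurableSet, Measure.restrict_restrict hNo.measurableSet,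
    inter_eq_left.2 hDΩ, inter_eq_left.2 (hND.trans hDΩ), setIntegral_const, setIntegral_const,
    ← NewtonF_eq hΩ, ← NewtonF_eq hΩ] at hmono
  have hF := hmin v hva
  simp only [smul_eq_mul] at hmono
  have hC := cC_pos
  have hπ := Real.pi_pos
  set err := 4 * Real.pi / cC * ε * (2 * (ω + 2 * R * (ε / ρ))) with herr
  have herr0 : 0 ≤ err := by positivity
  have hβ0 : 0 ≤ 1 / 2 - κ + κ ^ 2 := by nlinarith
  have hβ1 : 1 / 2 - κ + κ ^ 2 ≤ 1 := by nlinarith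
  have := mul_le_mul_of_nonneg_left hCr hβ0
  have := mul_le_mul_of_nonneg_right hβ1 herr0
  have := mul_le_mul_of_nonneg_left hDvol (sq_nonneg κ)
  nlinarith

lemma core (hΩ : IsConvexBody2 Ω) (hu : NewtonAdmissible Ω M u) (hM : 0 < M)
    (hmin : ∀ v : E2 → ℝ, NewtonAdmissible Ω M v → NewtonF Ω u ≤ NewtonF Ω v)
    {h : E2 → ℝ} (hconv : ConvexOn ℝ univ h) (hlip : ∀ x y, h x ≤ h y + ‖x - y‖)
    (hslope : ∀ x, ∀ η > 0, ∃ n : E2, ‖n‖ = 1 ∧ ∀ y, h x - η + ⟪n, y - x⟫ ≤ h y)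
    {z₀ : E2} {ρ δ : ℝ} (hρ : 0 < ρ) (hδ : 0 < δ)
    (hzL : z₀ ∈ interior (Lev Ω u M)) (hz : h z₀ ≤ -ρ)
    (hle : ∀ x ∈ Ω, u x ≤ M - (1 + δ) * h x) {c₁ ε₁ : ℝ} (hc₁ : 0 < c₁) (hε₁ : 0 < ε₁)
    (hvol : ∀ ε, 0 < ε → ε < ε₁ → 
      c₁ * ε ≤ volume.real (interior (Lev Ω u M) ∩ {x | -ε < h x})) : False := by
  obtain ⟨R, hR⟩ := hΩ.1.isBounded.exists_norm_le
  have hcont : Continuous h := by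
    have : LipschitzWith 1 h := LipschitzWith.of_le_add fun x y => by
      rw [dist_eq_norm]; exact hlip x y
    exact this.continuous
  have hzΩ : z₀ ∈ interior Ω := interior_mono (fun p hp => hp.1) hzL
  set V := volume.real (interior Ω) with hV
  set q := (1 + 1 / δ) with hq
  have hq0 : 0 < q := by positivity
  have hV0 : 0 ≤ V := measureReal_nonneg
  set C₁ := 2 * (q / ρ) * V + 1 with hC₁
  have hC₁0 : 0 < C₁ := by positivity
  set κ := min (1 / 2) (c₁ / (2 * C₁)) with hκ
  have hκ0 : 0 < κ := by positivity
  set C := 4 * Real.pi / cC with hC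
  have hC0 : 0 < C := div_pos (by positivity) cC_pos
  set ω := κ * c₁ / (16 * C) with hω
  have hω0 : 0 < ω := by positivity
  obtain ⟨τ, hτ, hnear⟩ := near_level hΩ hu hzL hω0
  have hR0 : 0 ≤ R := (norm_nonneg z₀).trans (hR z₀ (interior_subset hzΩ))
  have hev : ∀ᶠ ε in 𝓝[>] (0:ℝ), (ε * q < M ∧ ε * q < τ ∧ ε * q < ρ ∧ 2 * R * (ε / ρ) < ω ∧ ε < ε₁ ∧ ε < ρ) ∧ 0 < ε := by
    refine Filter.Eventually.and (Filter.Eventually.filter_mono nhdsWithin_le_nhds ?_)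
      self_mem_nhdsWithin
    have c1 : ContinuousAt (fun ε : ℝ => ε * q) 0 := by fun_prop
    have c2 : ContinuousAt (fun ε : ℝ => 2 * R * (ε / ρ)) 0 := by fun_prop
    refine (c1.eventually (gt_mem_nhds (by simpa using hM))).and <|
      (c1.eventually (gt_mem_nhds (by simpa using hτ))).and <|
      (c1.eventually (gt_mem_nhds (by simpa using hρ))).and <|
      (c2.eventually (gt_mem_nhds (by simpa using hω0))).and <| (gt_mem_nhds hε₁).and (gt_mem_nhds hρ)
  obtain ⟨ε, ⟨h1, h2, h3, h4, h5, h6⟩, hε⟩ := hev.exists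
  have hqe : ε * q = ε + ε / δ := by rw [hq]; field_simp
  have hmain := core_eps hΩ hu hmin hconv hlip hslope hρ hδ hε hω0 hzL hz hR hle
    (by rw [← hqe]; exact h1.le) (by rw [div_lt_one hρ]; exact h6)
    (fun x hx hlt => hnear x hx (by linarith)) hκ0.le (min_le_left _ _)
  have hlay := vol_layer (ε := ε) (c := ε / δ) (l := ε * q / ρ) hΩ hconv hcont hzΩ hz hε
    (by positivity) (by positivity) (by rw [div_lt_one hρ]; exact h3)
    (by rw [div_mul_cancel₀ _ hρ.ne', hqe])
  have hlay' : volume.real (interior Ω ∩ {x | -ε < h x ∧ h x < ε / δ}) ≤ C₁ * ε := by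
    have := ENNReal.toReal_mono (ENNReal.mul_ne_top ENNReal.ofReal_ne_top (vol_int_lt hΩ).ne) hlay
    rw [ENNReal.toReal_mul, ENNReal.toReal_ofReal (by positivity)] at this
    refine this.trans ?_
    show 2 * (ε * q / ρ) * V ≤ _
    rw [hC₁]
    have : 2 * (ε * q / ρ) * V = 2 * (q / ρ) * V * ε := by ring
    rw [this]; nlinarith
  have hv := hvol ε hε h5
  have k1 := mul_le_mul_of_nonneg_left hv hκ0.le
  have k2 := mul_le_mul_of_nonneg_left hlay' (sq_nonneg κ)
  have k3 : κ * C₁ ≤ c₁ / 2 := by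
    have := min_le_right (1 / 2) (c₁ / (2 * C₁))
    rw [← hκ, le_div_iff₀ (by positivity)] at this
    linarith
  have k4 : κ ^ 2 * (C₁ * ε) ≤ κ * c₁ / 2 * ε := by
    nlinarith [mul_le_mul_of_nonneg_left k3 (mul_nonneg hκ0.le hε.le)]
  have k5 : C * ε * (2 * (ω + 2 * R * (ε / ρ))) < C * ε * (4 * ω) := by
    apply mul_lt_mul_of_pos_left _ (by positivity); linarith
  have k6 : C * ε * (4 * ω) = κ * c₁ / 4 * ε := by
    rw [hω]; field_simp; norm_num
  have : 0 < κ * c₁ * ε := by positivity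
  linarith

end coreLemmas

/-- Boundary points of the level set with a steep support plane (with normals). -/
def SP (Ω : Set E2) (u : E2 → ℝ) (M δ : ℝ) : Set (E2 × E2) :=
  {p | p.1 ∈ frontier (Lev Ω u M) ∧ ‖p.2‖ = 1 ∧ ∀ x ∈ Ω, u x ≤ M - (1 + δ) * ⟪p.2, x - p.1⟫}

/-- The support-type function of the steep boundary points. -/
def hS (Ω : Set E2) (u : E2 → ℝ) (M δ : ℝ) (x : E2) : ℝ :=
  sSup ((fun p : E2 × E2 => ⟪p.2, x - p.1⟫) '' SP Ω u M δ)

section steepPoints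
variable {Ω : Set E2} {M δ : ℝ} {u : E2 → ℝ}

lemma Lev_closure (hΩ : IsConvexBody2 Ω) : closure (Lev Ω u M) ⊆ Ω :=
  closure_minimal (fun p hp => hp.1) hΩ.1.isClosed

lemma hS_bdd (hΩ : IsConvexBody2 Ω) (x : E2) :
    BddAbove ((fun p : E2 × E2 => ⟪p.2, x - p.1⟫) '' SP Ω u M δ) := by
  obtain ⟨R, hR⟩ := hΩ.1.isBounded.exists_norm_le
  refine ⟨‖x‖ + R, ?_⟩
  rintro _ ⟨⟨q, n⟩, ⟨hq, hn, -⟩, rfl⟩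
  have h1 := real_inner_le_norm n (x - q)
  simp only at hq hn ⊢
  rw [hn, one_mul] at h1
  have h2 := norm_sub_le x q
  have h3 := hR q (Lev_closure hΩ hq.1)
  linarith

lemma le_hS (hΩ : IsConvexBody2 Ω) {p : E2 × E2} (hp : p ∈ SP Ω u M δ) (x : E2) :
    ⟪p.2, x - p.1⟫ ≤ hS Ω u M δ x :=
  le_csSup (hS_bdd hΩ x) ⟨p, hp, rfl⟩

lemma hS_le (hne : (SP Ω u M δ).Nonempty) {x : E2} {c : ℝ}
    (h : ∀ p ∈ SP Ω u M δ, ⟪p.2, x - p.1⟫ ≤ c) : hS Ω u M δ x ≤ c := by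
  refine csSup_le (hne.image _) ?_
  rintro _ ⟨p, hp, rfl⟩
  exact h p hp

lemma hS_conv (hΩ : IsConvexBody2 Ω) (hne : (SP Ω u M δ).Nonempty) :
    ConvexOn ℝ univ (hS Ω u M δ) := by
  refine ⟨convex_univ, fun x _ y _ a b ha hb hab => hS_le hne fun p hp => ?_⟩
  have h1 := mul_le_mul_of_nonneg_left (le_hS hΩ hp x) ha
  have h2 := mul_le_mul_of_nonneg_left (le_hS hΩ hp y) hb
  have : a • x + b • y - p.1 = a • (x - p.1) + b • (y - p.1) := by
    obtain rfl : a = 1 - b := by linarith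
    module
  rw [this, inner_add_right, inner_smul_right, inner_smul_right]
  simp only [smul_eq_mul]
  linarith

lemma hS_lip (hΩ : IsConvexBody2 Ω) (hne : (SP Ω u M δ).Nonempty) (x y : E2) :
    hS Ω u M δ x ≤ hS Ω u M δ y + ‖x - y‖ := by
  refine hS_le hne fun p hp => ?_
  have h1 := le_hS hΩ hp y
  have h2 := real_inner_le_norm p.2 (x - y)
  rw [hp.2.1, one_mul] at h2
  have : x - p.1 = (y - p.1) + (x - y) := by abel
  rw [this, inner_add_right]
  linarith

lemma hS_slope (hΩ : IsConvexBody2 Ω) (hne : (SP Ω u M δ).Nonempty) (x : E2) (η : ℝ) (hη : 0 < η) :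
    ∃ n : E2, ‖n‖ = 1 ∧ ∀ y, hS Ω u M δ x - η + ⟪n, y - x⟫ ≤ hS Ω u M δ y := by
  obtain ⟨_, ⟨p, hp, rfl⟩, hlt⟩ := exists_lt_of_lt_csSup (hne.image
    (fun p : E2 × E2 => ⟪p.2, x - p.1⟫)) (show hS Ω u M δ x - η < _ from sub_lt_self _ hη)
  refine ⟨p.2, hp.2.1, fun y => ?_⟩
  have h1 := le_hS hΩ hp y
  have : y - p.1 = (x - p.1) + (y - x) := by abel
  rw [this, inner_add_right] at h1
  simp only at hlt
  linarith

lemma SP_lev (hδ : 0 < δ) {p : E2 × E2} (hp : p ∈ SP Ω u M δ) {x : E2}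
    (hx : x ∈ closure (Lev Ω u M)) : ⟪p.2, x - p.1⟫ ≤ 0 := by
  have : closure (Lev Ω u M) ⊆ {x | ⟪p.2, x - p.1⟫ ≤ 0} := by
    refine closure_minimal (fun y hy => ?_) (isClosed_le (by fun_prop) continuous_const)
    have h1 := hp.2.2 y hy.1
    rw [hy.2] at h1
    show ⟪p.2, y - p.1⟫ ≤ 0
    nlinarith
  exact this hx

lemma SP_center (hδ : 0 < δ) {z₀ : E2} {ρ : ℝ} (hρ : 0 < ρ)
    (hball : Metric.closedBall z₀ ρ ⊆ Lev Ω u M) {p : E2 × E2} (hp : p ∈ SP Ω u M δ) :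
    ρ ≤ ⟪p.2, p.1 - z₀⟫ := by
  have hmem : z₀ + ρ • p.2 ∈ Metric.closedBall z₀ ρ := by
    rw [mem_closedBall_iff_norm]
    simp [norm_smul, hp.2.1, abs_of_pos hρ]
  have h1 := SP_lev hδ hp (subset_closure (hball hmem))
  have : z₀ + ρ • p.2 - p.1 = ρ • p.2 - (p.1 - z₀) := by abel
  rw [this, inner_sub_right, inner_smul_right, real_inner_self_eq_norm_sq, hp.2.1] at h1
  linarith

lemma vol_lower (hΩ : IsConvexBody2 Ω) (hu : NewtonAdmissible Ω M u) (hδ : 0 < δ)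
    {z₀ : E2} {ρ : ℝ} (hρ : 0 < ρ)
    (hball : Metric.closedBall z₀ ρ ⊆ Lev Ω u M) (hne : (SP Ω u M δ).Nonempty)
    (hS0 : μH[1] (Prod.fst '' SP Ω u M δ) ≠ 0) :
    ∃ c₁ > 0, ∃ ε₁ > 0, ∀ ε, 0 < ε → ε < ε₁ → 
      c₁ * ε ≤ volume.real (interior (Lev Ω u M) ∩ {x | -ε < hS Ω u M δ x}) := by
  set L := Lev Ω u M with hL
  have hbi : Metric.ball z₀ ρ ⊆ interior L :=
    interior_maximal (Metric.ball_subset_closedBall.trans hball) Metric.isOpen_ball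
  obtain ⟨q₀, ⟨p₀, hp₀, rfl⟩, hpos⟩ := exists_mem_forall_mem_nhdsWithin_pos_measure hS0
  set q₀ := p₀.1 with hq₀
  set S' := Prod.fst '' SP Ω u M δ ∩ Metric.ball q₀ (ρ / 2) with hS'
  have hS'pos : 0 < μH[1] S' := hpos _ (inter_mem_nhdsWithin _ (Metric.ball_mem_nhds _ (half_pos hρ)))
  set W := ‖q₀ - z₀‖ with hW
  have hW0 : 0 < W := by
    have h1 := SP_center hδ hρ hball hp₀
    have h2 := real_inner_le_norm p₀.2 (p₀.1 - z₀)
    rw [hp₀.2.1, one_mul] at h2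
    linarith
  set e : E2 := W⁻¹ • (q₀ - z₀) with he
  have he1 : ‖e‖ = 1 := by
    rw [he, norm_smul, norm_inv, Real.norm_of_nonneg hW0.le, ← hW, inv_mul_cancel₀ hW0.ne']
  have heW : W • e = q₀ - z₀ := by rw [he, smul_inv_smul₀ hW0.ne']
  clear_value e
  set e' : E2 := !₂[-e 1, e 0] with he'
  have he'1 : ‖e'‖ = 1 := by
    rw [← he1, EuclideanSpace.norm_eq, EuclideanSpace.norm_eq]
    simp [he', add_comm]
  have hee : ⟪e', e⟫ = 0 := by
    simp [he', PiLp.inner_apply]; ring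
  obtain ⟨ψ, hψ, hψe⟩ := frame_mp he1 he'1 hee
  set κ := ρ / (2 * W) with hκ
  have hκ0 : 0 < κ := by positivity
  have hne' : ∀ p ∈ SP Ω u M δ, p.1 ∈ Metric.ball q₀ (ρ / 2) → κ ≤ ⟪p.2, e⟫ := by
    intro p hp hpb
    have h1 := SP_center hδ hρ hball hp
    have h2 := real_inner_le_norm p.2 (p.1 - q₀)
    rw [hp.2.1, one_mul] at h2
    rw [mem_ball_iff_norm] at hpb
    have h3 : p.1 - z₀ = (p.1 - q₀) + W • e := by rw [heW]; abel
    rw [h3, inner_add_right, inner_smul_right] at h1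
    rw [hκ, div_le_iff₀ (by positivity)]
    nlinarith
  -- graph estimate
  have hgraph1 : ∀ p ∈ SP Ω u M δ, p.1 ∈ Metric.ball q₀ (ρ / 2) → ∀ s t s' t' : ℝ, p.1 = ψ (s, t) →
      ψ (s', t') ∈ closure L → t' - t ≤ |s - s'| / κ := by
    intro p hp hpb s t s' t' hpe hcl
    have h1 := SP_lev hδ hp hcl
    have h2 := hne' p hp hpb
    rw [hpe, hψe, hψe] at h1
    have h3 : (s' • e' + t' • e) - (s • e' + t • e) = (t' - t) • e - (s - s') • e' := by module
    simp only at h1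
    rw [h3, inner_sub_right, inner_smul_right, inner_smul_right] at h1
    have h4 : |⟪p.2, e'⟫| ≤ 1 := by
      have := abs_real_inner_le_norm p.2 e'
      rwa [hp.2.1, he'1, one_mul] at this
    have h5 : (s - s') * ⟪p.2, e'⟫ ≤ |s - s'| := by
      refine (le_abs_self _).trans ?_
      rw [abs_mul]
      exact mul_le_of_le_one_right (abs_nonneg _) h4
    rw [le_div_iff₀ hκ0]
    rcases le_total (t' - t) 0 with h6 | h6
    · have := abs_nonneg (s - s'); nlinarith
    · nlinarith [mul_le_mul_of_nonneg_left h2 h6]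
  have hgraph : ∀ s t s' t', ψ (s, t) ∈ S' → ψ (s', t') ∈ S' → |t - t'| ≤ |s - s'| / κ := by
    rintro s t s' t' ⟨⟨p, hp, hpe⟩, hpb⟩ ⟨⟨p', hp', hpe'⟩, hpb'⟩
    rw [← hpe] at hpb
    rw [← hpe'] at hpb'
    have h1 := hgraph1 p hp hpb s t s' t' hpe (by rw [← hpe']; exact hp'.1.1)
    have h2 := hgraph1 p' hp' hpb' s' t' s t hpe' (by rw [← hpe]; exact hp.1.1)
    rw [abs_sub_comm s' s] at h2
    rw [abs_le]
    constructor <;> linarith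
  set pr : E2 → ℝ := fun x => (ψ.symm x).1 with hpr
  have hprψ : ∀ s t, pr (ψ (s, t)) = s := fun s t => by simp [hpr]
  set P := pr '' S' with hP
  have hdist : ∀ x ∈ S', ∀ y ∈ S', ‖x - y‖ ≤ (1 + 1 / κ) * |pr x - pr y| := by
    intro x hx y hy
    obtain ⟨⟨s, t⟩, rfl⟩ := ψ.surjective x
    obtain ⟨⟨s', t'⟩, rfl⟩ := ψ.surjective y
    have h1 := hgraph s t s' t' hx hy
    rw [hprψ, hprψ, hψe, hψe]
    have h3 : (s • e' + t • e) - (s' • e' + t' • e) = (s - s') • e' + (t - t') • e := by module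
    simp only
    rw [h3]
    refine (norm_add_le _ _).trans ?_
    rw [norm_smul, norm_smul, he1, he'1, Real.norm_eq_abs, Real.norm_eq_abs]
    have : (1 + 1 / κ) * |s - s'| = |s - s'| + |s - s'| / κ := by ring
    rw [this]; linarith
  have hPpos : 0 < volume P := by
    rw [pos_iff_ne_zero]
    intro h0
    set γ := Function.invFunOn pr S' with hγ
    have hγm : ∀ s ∈ P, γ s ∈ S' ∧ pr (γ s) = s := fun s hs =>
      ⟨Function.invFunOn_mem hs, Function.invFunOn_eq hs⟩
    have hK0 : (0:ℝ) ≤ 1 + 1 / κ := by positivity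
    have hlip : LipschitzOnWith (Real.toNNReal (1 + 1 / κ)) γ P := by
      refine LipschitzOnWith.of_dist_le_mul fun s hs s' hs' => ?_
      rw [Real.coe_toNNReal _ hK0, dist_eq_norm, Real.dist_eq]
      have := hdist _ (hγm s hs).1 _ (hγm s' hs').1
      rwa [(hγm s hs).2, (hγm s' hs').2] at this
    have hsub : S' ⊆ γ '' P := by
      intro x hx
      refine ⟨pr x, ⟨x, hx, rfl⟩, ?_⟩
      have h1 := hγm (pr x) ⟨x, hx, rfl⟩
      have h2 := hdist _ h1.1 _ hx
      rw [h1.2, sub_self, abs_zero, mul_zero] at h2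
      exact sub_eq_zero.1 (norm_le_zero_iff.1 h2)
    have h1 := (measure_mono hsub).trans (hlip.hausdorffMeasure_image_le (d := 1) zero_le_one)
    rw [hausdorffMeasure_real, h0, mul_zero] at h1
    exact absurd h1 (not_le.2 hS'pos)
  refine ⟨(min (volume P) 1).toReal, ENNReal.toReal_pos (lt_min hPpos one_pos).ne'
    (ne_top_of_le_ne_top ENNReal.one_ne_top (min_le_right _ _)), W, hW0, fun ε hε hεW => ?_⟩
  have hcont : Continuous (hS Ω u M δ) := by
    have : LipschitzWith 1 (hS Ω u M δ) := LipschitzWith.of_le_add fun x y => by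
      rw [dist_eq_norm]; exact hS_lip hΩ hne x y
    exact this.continuous
  set N := interior L ∩ {x | -ε < hS Ω u M δ x} with hN
  have hNo : IsOpen N := isOpen_interior.inter (isOpen_lt continuous_const hcont)
  have hNfin : volume N ≠ ⊤ := by
    refine ((measure_mono ?_).trans_lt (vol_int_lt hΩ)).ne
    exact inter_subset_left.trans (interior_mono fun p hp => hp.1)
  have hslice : ∀ s ∈ P, ∃ b : ℝ, ∀ t ∈ Ioo (b - ε) b, ψ (s, t) ∈ N := by
    rintro s ⟨x, ⟨⟨p, hp, rfl⟩, hpb⟩, rfl⟩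
    obtain ⟨⟨s, b⟩, hsb⟩ := ψ.surjective p.1
    refine ⟨b, fun t ht => ?_⟩
    rw [← hsb, hprψ]
    have h1 : ψ (s, t) = p.1 - (b - t) • e := by
      rw [← hsb, hψe, hψe]; module
    rw [h1]
    have ht0 : 0 < b - t := by linarith [ht.2]
    have ht1 : b - t < ε := by linarith [ht.1]
    constructor
    · have h2 : p.1 - W • e ∈ interior L := by
        apply hbi
        rw [mem_ball_iff_norm] at hpb ⊢
        rw [heW]
        have : p.1 - (q₀ - z₀) - z₀ = p.1 - q₀ := by abel
        rw [this]; linarith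
      have h3 := (Lev_convex hu).combo_interior_closure_mem_interior h2 hp.1.1
        (a := (b - t) / W) (b := 1 - (b - t) / W) (by positivity)
        (by rw [sub_nonneg, div_le_one hW0]; linarith) (by ring)
      convert h3 using 1
      have : ((b - t) / W) * W = b - t := div_mul_cancel₀ _ hW0.ne'
      rw [smul_sub, smul_smul, this]
      module
    · show -ε < _
      refine lt_of_lt_of_le ?_ (le_hS hΩ hp _)
      have h4 : p.1 - (b - t) • e - p.1 = -((b - t) • e) := by abel
      rw [h4, inner_neg_right, inner_smul_right]
      have h5 := real_inner_le_norm p.2 e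
      rw [hp.2.1, he1, one_mul] at h5
      nlinarith
  have hvol : ENNReal.ofReal ε * volume P ≤ volume N := by
    have hNm : MeasurableSet (ψ ⁻¹' N) := ψ.measurable hNo.measurableSet
    rw [← hψ.measure_preimage hNo.measurableSet.nullMeasurableSet, Measure.volume_eq_prod,
      Measure.prod_apply hNm]
    refine le_trans ?_ (mul_meas_ge_le_lintegral (measurable_measure_prodMk_left hNm) 
      (ENNReal.ofReal ε))
    gcongr
    intro s hs
    obtain ⟨b, hb⟩ := hslice s hs
    show ENNReal.ofReal ε ≤ volume _
    have : Ioo (b - ε) b ⊆ Prod.mk s ⁻¹' (ψ ⁻¹' N) := fun t ht => hb t ht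
    refine le_trans (le_of_eq ?_) (measure_mono this)
    rw [Real.volume_Ioo]; congr 1; ring
  have h1 : ENNReal.ofReal ε * min (volume P) 1 ≤ volume N :=
    le_trans (by gcongr; exact min_le_left _ _) hvol
  have h2 := ENNReal.toReal_mono hNfin h1
  rw [ENNReal.toReal_mul, ENNReal.toReal_ofReal hε.le] at h2
  rw [mul_comm]
  exact h2

lemma SP_null (hΩ : IsConvexBody2 Ω) (hu : NewtonAdmissible Ω M u) (hM : 0 < M)
    (hmin : ∀ v : E2 → ℝ, NewtonAdmissible Ω M v → NewtonF Ω u ≤ NewtonF Ω v)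
    (hint : (interior (Lev Ω u M)).Nonempty) (hδ : 0 < δ) :
    μH[1] (Prod.fst '' SP Ω u M δ) = 0 := by
  by_contra hS0
  have hne : (SP Ω u M δ).Nonempty := by
    rw [nonempty_iff_ne_empty]
    intro h0
    rw [h0] at hS0
    simp at hS0
  obtain ⟨z₀, hz₀⟩ := hint
  obtain ⟨ρ, hρ, hball⟩ := Metric.nhds_basis_closedBall.mem_iff.1 (mem_interior_iff_mem_nhds.1 hz₀)
  obtain ⟨c₁, hc₁, ε₁, hε₁, hvol⟩ := vol_lower hΩ hu hδ hρ hball hne hS0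
  refine core hΩ hu hM hmin (hS_conv hΩ hne) (hS_lip hΩ hne) (hS_slope hΩ hne) hρ hδ hz₀ ?_ ?_
    hc₁ hε₁ hvol
  · refine hS_le hne fun p hp => ?_
    have := SP_center hδ hρ hball hp
    rw [← neg_sub p.1 z₀, inner_neg_right]
    linarith
  · intro x hx
    have : hS Ω u M δ x ≤ (M - u x) / (1 + δ) := by
      refine hS_le hne fun p hp => ?_
      rw [le_div_iff₀ (by positivity)]
      have := hp.2.2 x hx
      linarith
    rw [le_div_iff₀ (by positivity)] at this
    linarith

end steepPoints

lemma limit_at_nice_point {Ω : Set E2} {M : ℝ} {u : E2 → ℝ}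
    (hΩ : IsConvexBody2 Ω) (hu : NewtonAdmissible Ω M u)
    (hmin : ∀ v : E2 → ℝ, NewtonAdmissible Ω M v → NewtonF Ω u ≤ NewtonF Ω v)
    (hint : (interior (Lev Ω u M)).Nonempty) {p₀ : E2}
    (hf : p₀ ∈ frontier (Lev Ω u M))
    (hnot : ∀ k : ℕ, p₀ ∉ Prod.fst '' SP Ω u M (1 / ((k : ℝ) + 1))) :
    Tendsto (fun p => ‖gradient u p‖)
      (𝓝[{p : E2 | p ∈ Ω ∧ u p < M ∧ DifferentiableAt ℝ u p}] p₀) (𝓝 1) := by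
  have hneL : {p : E2 | p ∈ Ω ∧ u p = M}.Nonempty := hint.mono interior_subset
  have hp₀ : p₀ ∈ interior Ω := by
    by_contra hb
    obtain ⟨n, hn, hn2⟩ := exists_normal hΩ hb
    refine hnot 0 ⟨(p₀, n), ⟨hf, hn, fun x hx => ?_⟩, rfl⟩
    have h1 := (hu.2 x hx).2
    have h2 := hn2 x hx
    simp only [Nat.cast_zero]
    linarith
  have hcont : ContinuousAt u p₀ :=
    (hu.1.continuousOn_interior).continuousAt (isOpen_interior.mem_nhds hp₀)
  have hM0 : u p₀ = M := by
    have h1 := hcont.continuousWithinAt.mem_closure_image hf.1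
    have h2 : closure (u '' Lev Ω u M) ⊆ {M} := by
      refine closure_minimal ?_ isClosed_singleton
      rintro _ ⟨x, hx, rfl⟩
      exact hx.2
    exact h2 h1
  obtain ⟨r, hr, hball⟩ := Metric.nhds_basis_closedBall.mem_iff.1 (mem_interior_iff_mem_nhds.1 hp₀)
  have hbdd : ∀ p, p ∈ Metric.ball p₀ (r / 2) → DifferentiableAt ℝ u p →
      ‖gradient u p‖ ≤ M / (r / 2) := by
    intro p hp hd
    set g := gradient u p with hg
    rcases eq_or_ne g 0 with h0 | h0
    · have := (hu.2 p₀ (interior_subset hp₀))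
      rw [h0, norm_zero]
      have hM' : 0 ≤ M := this.1.trans this.2
      positivity
    have hgn : 0 < ‖g‖ := norm_pos_iff.2 h0
    rw [mem_ball_iff_norm] at hp
    have hpΩ : p ∈ Ω := hball (by rw [mem_closedBall_iff_norm]; linarith)
    set y := p - (r / 2 / ‖g‖) • g with hy
    have hny : ‖(r / 2 / ‖g‖) • g‖ = r / 2 := by
      rw [norm_smul, Real.norm_of_nonneg (by positivity), div_mul_cancel₀ _ hgn.ne']
    have hyΩ : y ∈ Ω := by
      apply hball
      rw [mem_closedBall_iff_norm]
      have h1 : y - p₀ = (p - p₀) - (r / 2 / ‖g‖) • g := by rw [hy]; abel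
      rw [h1]
      refine (norm_sub_le _ _).trans ?_
      rw [hny]; linarith
    have h1 := support_of_diff hu.1 hpΩ hyΩ hd
    have h2 : y - p = -((r / 2 / ‖g‖) • g) := by rw [hy]; abel
    rw [h2, ← hg, inner_neg_right, inner_smul_right, real_inner_self_eq_norm_sq] at h1
    have h3 : r / 2 / ‖g‖ * ‖g‖ ^ 2 = ‖g‖ * (r / 2) := by field_simp
    rw [h3] at h1
    rw [le_div_iff₀ (by positivity)]
    have h4 := (hu.2 y hyΩ).1
    have h5 := (hu.2 p hpΩ).2
    linarith
  set D := {p : E2 | p ∈ Ω ∧ u p < M ∧ DifferentiableAt ℝ u p} with hD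
  have hupper : ∀ k : ℕ, ∀ᶠ p in 𝓝[D] p₀, ‖gradient u p‖ < 1 + 1 / ((k : ℝ) + 1) := by
    intro k
    by_contra hcon
    have hfr : ∃ᶠ p in 𝓝[D] p₀, ¬ ‖gradient u p‖ < 1 + 1 / ((k : ℝ) + 1) :=
      Filter.not_eventually.1 hcon
    have hev : ∀ᶠ p in 𝓝[D] p₀, p ∈ D ∧ p ∈ Metric.ball p₀ (r / 2) :=
      (eventually_mem_nhdsWithin).and
        (mem_nhdsWithin_of_mem_nhds (Metric.ball_mem_nhds _ (half_pos hr)))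
    obtain ⟨x, hx, hxP⟩ := exists_seq_forall_of_frequently (hfr.and_eventually hev)
    have hx0 : Tendsto x atTop (𝓝 p₀) := hx.mono_right nhdsWithin_le_nhds
    obtain ⟨ξ, -, φ, hφ, hξ⟩ := (isCompact_closedBall (0 : E2) (M / (r / 2))).tendsto_subseq
      (x := fun j => gradient u (x j)) (fun j => by
        rw [mem_closedBall_zero_iff]
        exact hbdd _ (hxP j).2.2 (hxP j).2.1.2.2)
    have hxφ : Tendsto (fun j => x (φ j)) atTop (𝓝 p₀) := hx0.comp hφ.tendsto_atTop
    have hξ' : Tendsto (fun j => gradient u (x (φ j))) atTop (𝓝 ξ) := hξ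
    have hξn : 1 + 1 / ((k : ℝ) + 1) ≤ ‖ξ‖ :=
      ge_of_tendsto' hξ'.norm fun j => not_lt.1 (hxP (φ j)).1
    have hsup : ∀ y ∈ Ω, u y ≤ M + ⟪ξ, y - p₀⟫ := by
      intro y hy
      have h1 : Tendsto (fun j => u (x (φ j)) + ⟪gradient u (x (φ j)), y - x (φ j)⟫) atTop
          (𝓝 (u p₀ + ⟪ξ, y - p₀⟫)) :=
        (hcont.tendsto.comp hxφ).add (hξ'.inner (tendsto_const_nhds.sub hxφ))
      rw [hM0] at h1
      exact ge_of_tendsto' h1 fun j =>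
        support_of_diff hu.1 (hxP (φ j)).2.1.1 hy (hxP (φ j)).2.1.2.2
    have hk : (0 : ℝ) < 1 / ((k : ℝ) + 1) := by positivity
    have hξ0 : 0 < ‖ξ‖ := by linarith
    refine hnot k ⟨(p₀, -(‖ξ‖⁻¹ • ξ)), ⟨hf, ?_, fun y hy => ?_⟩, rfl⟩
    · simp only [norm_neg, norm_smul, norm_inv, norm_norm]
      exact inv_mul_cancel₀ hξ0.ne'
    · have h1 := hsup y hy
      have h2 := (hu.2 y hy).2
      simp only [inner_neg_left, real_inner_smul_left]
      set t := ‖ξ‖⁻¹ * ⟪ξ, y - p₀⟫ with ht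
      have h3 : ⟪ξ, y - p₀⟫ = ‖ξ‖ * t := by rw [ht, mul_inv_cancel_left₀ hξ0.ne']
      rw [h3] at h1
      rcases le_total t 0 with h4 | h4
      · nlinarith
      · nlinarith
  have hlower : ∀ᶠ p in 𝓝[D] p₀, 1 ≤ ‖gradient u p‖ := by
    filter_upwards [eventually_mem_nhdsWithin] with p hp
    exact partA' hΩ hu hmin hneL hp.1 hp.2.2 hp.2.1
  rw [tendsto_order]
  constructor
  · intro a ha
    filter_upwards [hlower] with p hp using lt_of_lt_of_le ha hp
  · intro a ha
    obtain ⟨k, hk⟩ := exists_nat_one_div_lt (sub_pos.2 ha)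
    filter_upwards [hupper k] with p hp
    linarith

lemma main_aux (Ω : Set E2) (M : ℝ) (u : E2 → ℝ)
    (hΩ : IsConvexBody2 Ω) (hM : 0 < M)
    (hadm : NewtonAdmissible Ω M u)
    (hmin : ∀ v : E2 → ℝ, NewtonAdmissible Ω M v → NewtonF Ω u ≤ NewtonF Ω v)
    (hint : (interior (Lev Ω u M)).Nonempty) :
    ∀ᵐ p₀ ∂(μH[1].restrict (frontier (Lev Ω u M))),
      Tendsto (fun p => ‖gradient u p‖)
        (𝓝[{p : E2 | p ∈ Ω ∧ u p < M ∧ DifferentiableAt ℝ u p}] p₀)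
        (𝓝 1) := by
  rw [ae_restrict_iff' isClosed_frontier.measurableSet]
  have h : ∀ᵐ p₀ ∂(μH[1] : Measure E2), ∀ k : ℕ,
      p₀ ∉ Prod.fst '' SP Ω u M (1 / ((k : ℝ) + 1)) := by
    rw [ae_all_iff]
    intro k
    exact measure_eq_zero_iff_ae_notMem.1 (SP_null hΩ hadm hM hmin hint (by positivity))
  filter_upwards [h] with p₀ hp₀ hf
  exact limit_at_nice_point hΩ hadm hmin hint hf hp₀

/-- **Theorem 4 (paper Thm 1.4).** If `u_*` minimizes Newton's functional in the class of
concave functions `u : Ω → [0,M]` and the upper level set `L_M = {u_* = M}` has nonempty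
interior, then for `ℋ¹`-almost every point of `∂L_M` the gradient norm `|∇u_*|` tends to
`1` along regular points of `Ω \ L_M`. -/
theorem newton_gradient_limit_one_on_boundary_of_level_set
    (Ω : Set E2) (M : ℝ) (u : E2 → ℝ)
    (hΩ : IsConvexBody2 Ω) (hM : 0 < M)
    (hadm : NewtonAdmissible Ω M u)
    (hmin : ∀ v : E2 → ℝ, NewtonAdmissible Ω M v → NewtonF Ω u ≤ NewtonF Ω v)
    (hint : (interior {p : E2 | p ∈ Ω ∧ u p = M}).Nonempty) :
    ∀ᵐ p₀ ∂(μH[1].restrict (frontier {p : E2 | p ∈ Ω ∧ u p = M})),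
      Tendsto (fun p => ‖gradient u p‖)
        (𝓝[{p : E2 | p ∈ Ω ∧ u p < M ∧ DifferentiableAt ℝ u p}] p₀)
        (𝓝 1) := by
  exact main_aux Ω M u hΩ hM hadm hmin hint
end
end

section
/- Let Ω ⊂ ℝ² be a planar convex body, let M₀ = M₀(Ω) be the maximal radius of a disc contained in Ω, and let u_* minimize Newton's functional F(u) = ∫∫_Ω (1 + |∇u(x,y)|²)^{-1} dx dy in the class of concave functions u : Ω → [0, M]. If 0 < M < M₀, then the upper level set L_M = {(x,y) ∈ Ω : u_*(x,y) = M} has nonempty interior; moreover L_M contains the open disc concentric with a maximal inscribed disc of Ω and of radius M₀ − M. In particular, if Ω is a unit disc and M < 1, then L_M has nonempty interior. -/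
open MeasureTheory Set Filter Topology
open scoped RealInnerProductSpace ENNReal

noncomputable section

attribute [local instance] Classical.propDecidable

theorem newton_aux_tangent (Ω : Set E2) (u : E2 → ℝ) (hc : ConcaveOn ℝ Ω u) (p q : E2)
    (hp : p ∈ Ω) (hq : q ∈ Ω) (hd : DifferentiableAt ℝ u p) :
    u q ≤ u p + inner ℝ (gradient u p) (q - p) := by
  have h1 := hc.comp_affineMap (AffineMap.lineMap p q : ℝ →ᵃ[ℝ] E2)
  have hder : HasDerivAt (u ∘ (AffineMap.lineMap p q : ℝ →ᵃ[ℝ] E2))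
      (fderiv ℝ u p (q - p)) 0 := by
    have h2 : HasDerivAt (AffineMap.lineMap p q : ℝ →ᵃ[ℝ] E2) (q - p) (0 : ℝ) :=
      AffineMap.hasDerivAt_lineMap
    refine HasFDerivAt.comp_hasDerivAt (0 : ℝ) ?_ h2
    simpa using hd.hasFDerivAt
  have h3 := h1.slope_le_of_hasDerivAt (x := 0) (y := 1) (by simpa using hp) (by simpa using hq)
    one_pos hder
  have h4 : inner ℝ (gradient u p) (q - p) = fderiv ℝ u p (q - p) := by
    simp [gradient]
  rw [h4, map_sub]
  simp [slope_def_field] at h3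
  linarith

/-- **Proposition 1 of the paper.** Let `M₀` be the maximal radius of a disc contained in
`Ω` and let `u_*` minimize Newton's functional in the class of concave functions
`u : Ω → [0,M]` (so that `|∇u_*| ≥ 1` at regular points where `u_* < M`, a known result
taken as a hypothesis). If `0 < M < M₀`, then the upper level set `L_M = {u_* = M}`
contains the open disc concentric with a maximal inscribed disc and of radius `M₀ − M`;
in particular `L_M` has nonempty interior. -/
theorem newton_level_set_has_nonempty_interior
    (Ω : Set E2) (M M₀ : ℝ) (c : E2) (u : E2 → ℝ)
    (hΩ : IsConvexBody2 Ω)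
    (hball : Metric.closedBall c M₀ ⊆ Ω)
    (hmax : ∀ (c' : E2) (r : ℝ), Metric.closedBall c' r ⊆ Ω → r ≤ M₀)
    (hM : 0 < M) (hMM₀ : M < M₀)
    (hadm : NewtonAdmissible Ω M u)
    (hmin : ∀ v : E2 → ℝ, NewtonAdmissible Ω M v → NewtonF Ω u ≤ NewtonF Ω v)
    (hgrad : ∀ p ∈ Ω, u p < M → DifferentiableAt ℝ u p → 1 ≤ ‖gradient u p‖) :
    Metric.ball c (M₀ - M) ⊆ {p : E2 | p ∈ Ω ∧ u p = M} ∧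
    (interior {p : E2 | p ∈ Ω ∧ u p = M}).Nonempty := by
  obtain ⟨hconc, hu⟩ := hadm
  have hsub : Metric.ball c (M₀ - M) ⊆ Ω :=
    (Metric.ball_subset_closedBall.trans (Metric.closedBall_subset_closedBall (by linarith))).trans
      hball
  -- regular points of the ball
  have key : ∀ p ∈ Metric.ball c (M₀ - M), DifferentiableAt ℝ u p → ¬ u p < M := by
    intro p hp hd hlt
    have hg := hgrad p (hsub hp) hlt hd
    set g := gradient u p with hgdef
    have hg0 : 0 < ‖g‖ := by linarith
    set q : E2 := p - (M / ‖g‖) • g with hqdef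
    have hqp : ‖q - p‖ = M := by
      have : q - p = -((M / ‖g‖) • g) := by rw [hqdef]; abel
      rw [this, norm_neg, norm_smul, Real.norm_of_nonneg (by positivity)]
      field_simp
    have hq : q ∈ Ω := by
      apply hball
      rw [Metric.mem_closedBall]
      rw [Metric.mem_ball] at hp
      have := dist_triangle q p c
      rw [dist_eq_norm q p, hqp] at this
      linarith
    have h := newton_aux_tangent Ω u hconc p q (hsub hp) hq hd
    have h2 : inner ℝ (gradient u p) (q - p) = -(M * ‖g‖) := by
      have : q - p = -((M / ‖g‖) • g) := by rw [hqdef]; abel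
      rw [this, ← hgdef, inner_neg_right, inner_smul_right, real_inner_self_eq_norm_sq]
      field_simp
    rw [h2] at h
    have h0 := (hu q hq).1
    nlinarith
  have main : Metric.ball c (M₀ - M) ⊆ {p : E2 | p ∈ Ω ∧ u p = M} := by
    intro p hp
    refine ⟨hsub hp, ?_⟩
    by_contra hne
    have hlt : u p < M := lt_of_le_of_ne (hu p (hsub hp)).2 hne
    have hcb : ConcaveOn ℝ (Metric.ball c (M₀ - M)) u := hconc.subset hsub (convex_ball _ _)
    obtain ⟨K, t, ht, hL⟩ := hcb.locallyLipschitzOn Metric.isOpen_ball hp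
    rw [Metric.isOpen_ball.nhdsWithin_eq hp] at ht
    have hcont : ContinuousAt u p :=
      (hcb.continuousOn Metric.isOpen_ball).continuousAt (Metric.isOpen_ball.mem_nhds hp)
    have hW : {x | (x ∈ Metric.ball c (M₀ - M) ∧ u x < M) ∧ x ∈ interior t} ∈ 𝓝 p := by
      filter_upwards [Metric.isOpen_ball.mem_nhds hp, hcont.eventually (gt_mem_nhds hlt),
        interior_mem_nhds.2 ht] with x h1 h2 h3
      exact ⟨⟨h1, h2⟩, h3⟩
    have hae : ∀ᵐ x ∂(volume : Measure E2), x ∈ t → DifferentiableWithinAt ℝ u t x :=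
      hL.ae_differentiableWithinAt_of_mem
    obtain ⟨x, hx1, hx2⟩ := (Measure.dense_of_ae hae).inter_nhds_nonempty hW
    exact key x hx2.1.1 ((hx1 (interior_subset hx2.2)).differentiableAt
      (mem_interior_iff_mem_nhds.1 hx2.2)) hx2.1.2
  exact ⟨main, c, mem_interior.2 ⟨_, main, Metric.isOpen_ball,
    Metric.mem_ball_self (by linarith)⟩⟩
end
end
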